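/- For every integer r ≥ 1, the 𝔽₂-vector space (QP_6)_{5(2^{r+4}−1)+23·2^{r+4}} has dimension 78435; equivalently, there exist exactly 78435 admissible monomials of degree 5(2^{r+4}−1)+23·2^{r+4} in P_6. -/

import Mathlib

open MvPolynomial

noncomputable section

/-- `P n` is the polynomial algebra `𝔽₂[x_1, …, x_n]`. -/
abbrev P (n : ℕ) : Type := MvPolynomial (Fin n) (ZMod 2)

/-- The total Steenrod square: the `𝔽₂`-algebra endomorphism of `P n`
with `Sq (x_j) = x_j + x_j ^ 2`. -/
def SqT (n : ℕ) : P n →ₐ[ZMod 2] P n := aeval fun j => X j + X j ^ 2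

/-- `u` is hit (in degree `d`): `u = ∑_{i ≥ 1} Sq^i (f i)` where `f i` is homogeneous
of degree `d - i`; here `Sq^i (f i)` is the degree-`d` homogeneous component of
`Sq (f i)`. -/
def IsHit (n d : ℕ) (u : P n) : Prop :=
  ∃ f : ℕ → P n,
    (∀ i, f i ∈ homogeneousSubmodule (Fin n) (ZMod 2) (d - i)) ∧
    u = ∑ i ∈ Finset.Icc 1 d, homogeneousComponent d (SqT n (f i))

/-- The homogeneous part `(P_n)_d`. -/
abbrev homSub (n d : ℕ) : Submodule (ZMod 2) (P n) := homogeneousSubmodule (Fin n) (ZMod 2) d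

/-- The subspace of hit elements of degree `d` (the span of the set of hit elements;
this set is already closed under addition, so this is just the set of hit elements). -/
def hitSub (n d : ℕ) : Submodule (ZMod 2) (P n) := Submodule.span (ZMod 2) {u | IsHit n d u}

/-- The cohit space `(QP_n)_d = (P_n)_d / (A⁺P_n)_d`. -/
abbrev QP (n d : ℕ) : Type :=
  ↥(homSub n d) ⧸ (hitSub n d).comap (homSub n d).subtype

/-- The class `[f]` in `(QP_n)_d` of a polynomial `f` (via its degree-`d` homogeneous
component; for `f` homogeneous of degree `d` this is the class of `f` itself). -/
def cls (n d : ℕ) (f : P n) : QP n d :=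
  Submodule.Quotient.mk
    ⟨homogeneousComponent d f,
      (mem_homogeneousSubmodule _ _).2 (homogeneousComponent_isHomogeneous d f)⟩

/-- The monomial `x^a = x_1^{a_1} ⋯ x_n^{a_n}`. -/
def mono {n : ℕ} (a : Fin n →₀ ℕ) : P n := monomial a 1

/-- The (total) degree of the monomial with exponent vector `a`. -/
def degA {n : ℕ} (a : Fin n →₀ ℕ) : ℕ := ∑ i, a i

/-- The weight vector: `wVec a t = ω_{t+1}(x^a) = ∑_j α_t(a_j)`. -/
def wVec {n : ℕ} (a : Fin n →₀ ℕ) : ℕ → ℕ :=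
  fun t => ∑ j, if Nat.testBit (a j) t then 1 else 0

/-- Left lexicographic (strict) order on sequences. -/
def lexLtN (f g : ℕ → ℕ) : Prop := ∃ i, (∀ j, j < i → f j = g j) ∧ f i < g i

/-- Left lexicographic (strict) order on exponent vectors. -/
def lexLtS {n : ℕ} (a b : Fin n →₀ ℕ) : Prop :=
  ∃ i : Fin n, (∀ j, j < i → a j = b j) ∧ a i < b i

/-- The order on monomials: `u < v` iff `ω(u) < ω(v)` lexicographically, or
`ω(u) = ω(v)` and `σ(u) < σ(v)` lexicographically. -/
def monLt {n : ℕ} (a b : Fin n →₀ ℕ) : Prop :=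
  lexLtN (wVec a) (wVec b) ∨ (wVec a = wVec b ∧ lexLtS a b)

/-- A monomial is admissible iff it is not inadmissible, i.e. there is no finite set of
monomials of the same degree, all smaller than it, such that subtracting their sum
yields a hit polynomial. -/
def Admissible {n : ℕ} (a : Fin n →₀ ℕ) : Prop :=
  ¬ ∃ S : Finset (Fin n →₀ ℕ),
      (∀ b ∈ S, degA b = degA a ∧ monLt b a) ∧
      IsHit n (degA a) (mono a - ∑ b ∈ S, mono b)

/-- `P_n^0`: the span of the monomials in which some variable has exponent `0`. -/
def PzeroSub (n : ℕ) : Submodule (ZMod 2) (P n) :=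
  Submodule.span (ZMod 2) {x : P n | ∃ a : Fin n →₀ ℕ, (∃ i, a i = 0) ∧ x = mono a}

/-- `P_n^+`: the span of the monomials in which every variable occurs. -/
def PplusSub (n : ℕ) : Submodule (ZMod 2) (P n) :=
  Submodule.span (ZMod 2) {x : P n | ∃ a : Fin n →₀ ℕ, (∀ i, 0 < a i) ∧ x = mono a}

/-- `(QP_n^0)_d`: the image of `(P_n^0)_d` in `(QP_n)_d`. -/
def Qzero (n d : ℕ) : Submodule (ZMod 2) (QP n d) :=
  (((PzeroSub n).comap (homSub n d).subtype)).map
    ((hitSub n d).comap (homSub n d).subtype).mkQ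

/-- `(QP_n^+)_d`: the image of `(P_n^+)_d` in `(QP_n)_d`. -/
def Qplus (n d : ℕ) : Submodule (ZMod 2) (QP n d) :=
  (((PplusSub n).comap (homSub n d).subtype)).map
    ((hitSub n d).comap (homSub n d).subtype).mkQ

/-- Kameko-type map `S_5 : P_5 → P_5`, the `𝔽₂`-linear map with
`S_5(x_1x_2x_3x_4x_5 · y²) = y` on monomials of that form and `S_5 = 0` on all
other monomials. -/
def S5 : P 5 →ₗ[ZMod 2] P 5 :=
  (basisMonomials (Fin 5) (ZMod 2)).constr (ZMod 2) fun a =>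
    if ∀ i, Odd (a i) then mono (Finsupp.equivFunOnFinite.symm fun i => a i / 2) else 0

/-- `Φ(f) = x_1x_2x_3x_4x_5 · f²`. -/
def Phi (f : P 5) : P 5 := (∏ i : Fin 5, X i) * f ^ 2

section
abbrev Fn (k : ℕ) : Type := P k →ₗ[ZMod 2] ZMod 2

theorem mono_add {k : ℕ} (a b : Fin k →₀ ℕ) : mono (a + b) = mono a * mono b := by
  simp [mono, monomial_mul]
theorem mono_zero {k : ℕ} : mono (0 : Fin k →₀ ℕ) = 1 := rfl
theorem mono_single {k : ℕ} (i : Fin k) : mono (Finsupp.single i 1) = X i := rfl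
theorem degA_add {k : ℕ} (a b : Fin k →₀ ℕ) : degA (a + b) = degA a + degA b := by
  simp [degA, Finset.sum_add_distrib]
theorem degA_zero {k : ℕ} : degA (0 : Fin k →₀ ℕ) = 0 := by simp [degA]
theorem degA_single {k : ℕ} (i : Fin k) (n : ℕ) : degA (Finsupp.single i n) = n := by
  simp [degA, Finsupp.single_apply]
theorem degA_eq_degree {k : ℕ} (a : Fin k →₀ ℕ) : degA a = a.degree := by
  simp [degA, Finsupp.degree_eq_sum]

theorem Fn_ext {k : ℕ} {φ ψ : Fn k} (h : ∀ a, φ (mono a) = ψ (mono a)) : φ = ψ := by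
  apply (basisMonomials (Fin k) (ZMod 2)).ext
  intro a; simpa [coe_basisMonomials, mono] using h a

theorem map_ext_mono {k : ℕ} {M : Type*} [AddCommMonoid M] [Module (ZMod 2) M] {φ ψ : P k →ₗ[ZMod 2] M}
    (h : ∀ a, φ (mono a) = ψ (mono a)) : φ = ψ := by
  apply (basisMonomials (Fin k) (ZMod 2)).ext
  intro a; simpa [coe_basisMonomials, mono] using h a

def ofM {k : ℕ} (c : (Fin k →₀ ℕ) → ZMod 2) : Fn k :=
  (basisMonomials (Fin k) (ZMod 2)).constr (ZMod 2) c
theorem ofM_mono {k : ℕ} (c : (Fin k →₀ ℕ) → ZMod 2) (a) : ofM c (mono a) = c a := by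
  have := (basisMonomials (Fin k) (ZMod 2)).constr_basis (ZMod 2) c a
  simpa [coe_basisMonomials, mono, ofM] using this

/-- exponent induction -/
theorem exp_ind {k : ℕ} {Q : (Fin k →₀ ℕ) → Prop} (h0 : Q 0) (h1 : ∀ i, Q (Finsupp.single i 1))
    (hadd : ∀ a b, Q a → Q b → Q (a + b)) (a) : Q a := by
  induction a using Finsupp.induction_linear with
  | zero => exact h0
  | add f g hf hg => exact hadd _ _ hf hg
  | single i n =>
    induction n with
    | zero => simpa using h0
    | succ n ih => rw [Finsupp.single_add]; exact hadd _ _ ih (h1 i)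

def Sup {k : ℕ} (d : ℕ) (φ : Fn k) : Prop := ∀ a, degA a ≠ d → φ (mono a) = 0

def Sp (k : ℕ) (s : Set ℕ) : Submodule (ZMod 2) (P k) :=
  Submodule.span (ZMod 2) {f | ∃ a, degA a ∈ s ∧ f = mono a}

theorem mono_mem_Sp {k : ℕ} {s : Set ℕ} {a : Fin k →₀ ℕ} (h : degA a ∈ s) : mono a ∈ Sp k s :=
  Submodule.subset_span ⟨a, h, rfl⟩

theorem mul_mem_Sp {k : ℕ} {s t u : Set ℕ} (h : ∀ x ∈ s, ∀ y ∈ t, x + y ∈ u) {f g : P k}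
    (hf : f ∈ Sp k s) (hg : g ∈ Sp k t) : f * g ∈ Sp k u := by
  induction hf using Submodule.span_induction with
  | mem f hf =>
    obtain ⟨a, ha, rfl⟩ := hf
    induction hg using Submodule.span_induction with
    | mem g hg =>
      obtain ⟨b, hb, rfl⟩ := hg
      rw [← mono_add]; exact mono_mem_Sp (by rw [degA_add]; exact h _ ha _ hb)
    | zero => simp
    | add x y _ _ hx hy => rw [mul_add]; exact add_mem hx hy
    | smul c x _ hx => rw [mul_smul_comm]; exact Submodule.smul_mem _ _ hx
  | zero => simp
  | add x y _ _ hx hy => rw [add_mul]; exact add_mem hx hy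
  | smul c x _ hx => rw [smul_mul_assoc]; exact Submodule.smul_mem _ _ hx

theorem Sp_mono {k : ℕ} {s t : Set ℕ} (h : s ⊆ t) : Sp k s ≤ Sp k t :=
  Submodule.span_mono (by rintro f ⟨a, ha, rfl⟩; exact ⟨a, h ha, rfl⟩)

theorem Sup.eq_zero {k d : ℕ} {φ : Fn k} (h : Sup d φ) {s : Set ℕ} (hs : d ∉ s) {f : P k} (hf : f ∈ Sp k s) :
    φ f = 0 := by
  induction hf using Submodule.span_induction with
  | mem f hf =>
    obtain ⟨a, ha, rfl⟩ := hf
    exact h a (fun e => hs (e ▸ ha))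
  | zero => simp
  | add x y _ _ hx hy => simp [hx, hy]
  | smul c x _ hx => simp [hx]

theorem X_mem_Sp {k : ℕ} (i : Fin k) : (X i : P k) ∈ Sp k {1} := by
  rw [← mono_single]; exact mono_mem_Sp (by simp [degA_single])

theorem SqT_X {k : ℕ} (i : Fin k) : SqT k (X i) = X i + X i ^ 2 := by simp [SqT]

theorem SqT_mono_sub {k : ℕ} (a : Fin k →₀ ℕ) : SqT k (mono a) - mono a ∈ Sp k (Set.Ioi (degA a)) := by
  induction a using exp_ind with
  | h0 => simp [mono_zero]
  | h1 i =>
    rw [mono_single, SqT_X, add_sub_cancel_left, degA_single, sq]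
    exact mul_mem_Sp (by simp) (X_mem_Sp i) (X_mem_Sp i)
  | hadd a b ha hb =>
    have e : SqT k (mono (a + b)) - mono (a + b) = mono a * (SqT k (mono b) - mono b)
      + (SqT k (mono a) - mono a) * mono b + (SqT k (mono a) - mono a) * (SqT k (mono b) - mono b) := by
      rw [mono_add, map_mul]; ring
    rw [e, degA_add]
    have hma := mono_mem_Sp (k := k) (s := {degA a}) (a := a) rfl
    have hmb := mono_mem_Sp (k := k) (s := {degA b}) (a := b) rfl
    refine add_mem (add_mem (mul_mem_Sp ?_ hma hb) (mul_mem_Sp ?_ ha hmb)) (mul_mem_Sp ?_ ha hb) <;>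
    · intro x hx y hy; simp at *; omega

theorem Sup.Sq_eq {k d : ℕ} {φ : Fn k} (h : Sup d φ) {a : Fin k →₀ ℕ} (ha : d ≤ degA a) :
    φ (SqT k (mono a)) = φ (mono a) := by
  have := h.eq_zero (s := Set.Ioi (degA a)) (by simpa using ha) (SqT_mono_sub a)
  rwa [map_sub, sub_eq_zero] at this

/-- Lemma Z -/
theorem Sup.Z {k d : ℕ} {φ : Fn k} (h : Sup d φ) (h0 : ∀ f, φ (SqT k f) = 0) : φ = 0 := by
  apply Fn_ext; intro a
  by_cases ha : degA a = d
  · rw [← h.Sq_eq ha.ge, h0]; rfl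
  · rw [h a ha]; rfl

def K (k d : ℕ) : Submodule (ZMod 2) (Fn k) where
  carrier := {φ | Sup d φ ∧ ∀ f, φ (SqT k f) = φ f}
  add_mem' := by
    rintro a b ⟨ha, ha'⟩ ⟨hb, hb'⟩
    exact ⟨fun x hx => by simp [ha x hx, hb x hx], fun f => by simp [ha', hb']⟩
  zero_mem' := ⟨fun x hx => rfl, fun f => rfl⟩
  smul_mem' := by
    rintro c a ⟨ha, ha'⟩
    exact ⟨fun x hx => by simp [ha x hx], fun f => by simp [ha']⟩

theorem mem_K {k d : ℕ} {φ : Fn k} : φ ∈ K k d ↔ Sup d φ ∧ ∀ f, φ (SqT k f) = φ f := Iff.rfl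

theorem K_iff_mono {k d : ℕ} {φ : Fn k} : φ ∈ K k d ↔ Sup d φ ∧ ∀ a, degA a < d → φ (SqT k (mono a)) = 0 := by
  rw [mem_K]
  refine and_congr_right fun h => ⟨fun h2 a ha => by rw [h2, h a ha.ne], fun h2 => ?_⟩
  have : φ ∘ₗ (SqT k).toLinearMap = φ := by
    apply Fn_ext; intro a
    by_cases ha : degA a < d
    · simp [h2 a ha, h a ha.ne]
    · simpa using h.Sq_eq (not_lt.1 ha)
  intro f
  exact congrArg (fun g => g f) this

/-! hits -/
theorem hom_of_mono {k : ℕ} (a : Fin k →₀ ℕ) : (mono a : P k) ∈ homSub k (degA a) := by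
  rw [mem_homogeneousSubmodule, degA_eq_degree]
  exact isHomogeneous_monomial _ (by rfl)

theorem hom_le_Sp {k e : ℕ} {f : P k} (hf : f ∈ homSub k e) : f ∈ Sp k {e} := by
  rw [mem_homogeneousSubmodule] at hf
  rw [f.as_sum]
  refine sum_mem fun a ha => ?_
  have h1 : degA a = e := by
    have := hf (mem_support_iff.1 ha)
    rw [degA_eq_degree, ← this, Finsupp.degree_eq_weight_one]; rfl
  have h2 : monomial a (coeff a f) = coeff a f • (mono a : P k) := by simp [mono, smul_monomial]
  rw [h2]; exact Submodule.smul_mem _ _ (mono_mem_Sp (by simp [h1]))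

theorem hc_mono {k d : ℕ} (a : Fin k →₀ ℕ) :
    homogeneousComponent d (mono a : P k) = if degA a = d then mono a else 0 := by
  split_ifs with h
  · have := hom_of_mono a
    rw [h] at this
    exact homogeneousComponent_of_mem this |>.trans (by simp)
  · exact (homogeneousComponent_of_mem (hom_of_mono a)).trans (if_neg (Ne.symm h))

theorem Sup.hc {k d : ℕ} {φ : Fn k} (h : Sup d φ) (f : P k) : φ (homogeneousComponent d f) = φ f := by
  have : φ ∘ₗ (homogeneousComponent d) = φ := by
    apply Fn_ext; intro a
    rw [LinearMap.comp_apply, hc_mono]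
    split_ifs with ha
    · rfl
    · rw [h a ha, map_zero]
  exact congrArg (fun g => g f) this

theorem K_hit {k d : ℕ} {φ : Fn k} (h : φ ∈ K k d) {u : P k} (hu : u ∈ hitSub k d) : φ u = 0 := by
  induction hu using Submodule.span_induction with
  | mem u hu =>
    obtain ⟨f, hf, rfl⟩ := hu
    rw [map_sum]
    refine Finset.sum_eq_zero fun i hi => ?_
    rw [h.1.hc, h.2]
    refine h.1.eq_zero (s := {d - i}) ?_ (hom_le_Sp (hf i))
    simp at *; omega
  | zero => simp
  | add x y _ _ hx hy => simp [hx, hy]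
  | smul c x _ hx => simp [hx]

theorem hit_of {k d : ℕ} {a : Fin k →₀ ℕ} (ha : degA a < d) : 
    homogeneousComponent d (SqT k (mono a)) ∈ hitSub k d := by
  refine Submodule.subset_span ⟨fun i => if i = d - degA a then mono a else 0, fun i => ?_, ?_⟩
  · dsimp only
    split_ifs with h
    · have := hom_of_mono a
      rwa [show degA a = d - i by omega] at this
    · exact zero_mem _
  · rw [Finset.sum_eq_single (d - degA a)]
    · simp
    · intro b _ hb; simp [hb]
    · intro h; simp at h; omega

def hcL (k d : ℕ) : P k →ₗ[ZMod 2] homSub k d :=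
  (homogeneousComponent d).codRestrict _ fun f => (mem_homogeneousSubmodule _ _).2 (homogeneousComponent_isHomogeneous d f)

def KDual (k d : ℕ) : K k d ≃ₗ[ZMod 2] Module.Dual (ZMod 2) (QP k d) where
  toFun φ := Submodule.liftQ _ (φ.1 ∘ₗ (homSub k d).subtype) (by
    intro x hx; exact K_hit φ.2 hx)
  map_add' φ ψ := by apply Submodule.linearMap_qext; rfl
  map_smul' c φ := by apply Submodule.linearMap_qext; rfl
  invFun l := ⟨l ∘ₗ Submodule.mkQ _ ∘ₗ hcL k d, by
    rw [K_iff_mono]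
    constructor
    · intro a ha
      have : hcL k d (mono a) = 0 := by
        apply Subtype.ext; simp [hcL, hc_mono, ha]
      simp [this]
    · intro a ha
      have : Submodule.mkQ ((hitSub k d).comap (homSub k d).subtype) (hcL k d (SqT k (mono a))) = 0 := by
        rw [Submodule.mkQ_apply, Submodule.Quotient.mk_eq_zero]
        exact hit_of ha
      simp only [LinearMap.comp_apply]
      rw [this, map_zero]⟩
  left_inv φ := by
    apply Subtype.ext; apply LinearMap.ext; intro f
    exact φ.2.1.hc f
  right_inv l := by
    apply Submodule.linearMap_qext
    apply LinearMap.ext; intro x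
    change l (Submodule.mkQ _ (hcL k d x.1)) = l (Submodule.mkQ _ x)
    have : hcL k d x.1 = x := by
      apply Subtype.ext
      exact (homogeneousComponent_of_mem x.2).trans (if_pos rfl)
    rw [this]

theorem finrank_QP (k d : ℕ) : Module.finrank (ZMod 2) (QP k d) = Module.finrank (ZMod 2) (K k d) := by
  rw [(KDual k d).finrank_eq, Subspace.dual_finrank_eq]
end

section
theorem two_P {k : ℕ} (f : P k) : f + f = 0 := CharTwo.add_self_eq_zero f
theorem sq_add_P {k : ℕ} (f g : P k) : (f + g) ^ 2 = f ^ 2 + g ^ 2 := CharTwo.add_sq f g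

def sqL (k : ℕ) : P k →ₗ[ZMod 2] P k where
  toFun f := f ^ 2
  map_add' f g := sq_add_P f g
  map_smul' c f := by
    have : c ^ 2 = c := by revert c; decide
    rw [smul_pow, this]; rfl

def XI {k : ℕ} (I : Finset (Fin k)) : P k := ∏ i ∈ I, X i

def cap {k : ℕ} (g : P k) : Fn k →ₗ[ZMod 2] Fn k := LinearMap.lcomp (ZMod 2) (ZMod 2) (LinearMap.mulLeft (ZMod 2) g)
theorem cap_apply {k : ℕ} (g : P k) (φ : Fn k) (f) : cap g φ f = φ (g * f) := rfl

def par {k : ℕ} (I : Finset (Fin k)) : Fn k →ₗ[ZMod 2] Fn k :=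
  LinearMap.lcomp (ZMod 2) (ZMod 2) (LinearMap.mulLeft (ZMod 2) (XI I) ∘ₗ sqL k)
theorem par_apply {k : ℕ} (I : Finset (Fin k)) (φ : Fn k) (f) : par I φ f = φ (XI I * f ^ 2) := rfl

def oddS {k : ℕ} (a : Fin k →₀ ℕ) : Finset (Fin k) := Finset.univ.filter fun i => a i % 2 = 1
def halfE {k : ℕ} (a : Fin k →₀ ℕ) : Fin k →₀ ℕ := Finsupp.equivFunOnFinite.symm fun i => a i / 2
def indE {k : ℕ} (I : Finset (Fin k)) : Fin k →₀ ℕ := Finsupp.equivFunOnFinite.symm fun i => if i ∈ I then 1 else 0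

theorem mono_eq_prod {k : ℕ} (a : Fin k →₀ ℕ) : (mono a : P k) = ∏ i, X i ^ a i := by
  rw [mono, monomial_eq]; simp [Finsupp.prod_fintype]

theorem XI_eq {k : ℕ} (I : Finset (Fin k)) : XI I = mono (indE I) := by
  have h : ∀ i : Fin k, (X i : P k) ^ (indE I) i = if i ∈ I then X i else 1 := by
    intro i; by_cases h : i ∈ I <;> simp [indE, h]
  rw [mono_eq_prod, XI, Finset.prod_congr rfl (fun i _ => h i), Finset.prod_ite_mem, Finset.univ_inter]

theorem mono_sq {k : ℕ} (a : Fin k →₀ ℕ) : (mono a : P k) ^ 2 = mono (2 • a) := by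
  rw [two_smul, mono_add, sq]

theorem exp_split {k : ℕ} (a : Fin k →₀ ℕ) : a = indE (oddS a) + 2 • halfE a := by
  ext i; simp [indE, oddS, halfE]
  split_ifs with h <;> omega

theorem mono_split {k : ℕ} (a : Fin k →₀ ℕ) : (mono a : P k) = XI (oddS a) * mono (halfE a) ^ 2 := by
  rw [mono_sq, XI_eq, ← mono_add, ← exp_split]

theorem oddS_eq {k : ℕ} (I : Finset (Fin k)) (b) : oddS (indE I + 2 • b) = I := by
  ext i; simp [oddS, indE]; split_ifs with h <;> simp [h]
theorem halfE_eq {k : ℕ} (I : Finset (Fin k)) (b) : halfE (indE I + 2 • b) = b := by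
  ext i; simp [halfE, indE]; split_ifs with h <;> omega

theorem degA_indE {k : ℕ} (I : Finset (Fin k)) : degA (indE I) = I.card := by
  simp [degA, indE]
theorem degA_two {k : ℕ} (a : Fin k →₀ ℕ) : degA (2 • a) = 2 * degA a := by
  rw [two_smul, degA_add]; omega

theorem XI_mono_sq {k : ℕ} (I : Finset (Fin k)) (b) : (XI I * mono b ^ 2 : P k) = mono (indE I + 2 • b) := by
  rw [mono_sq, XI_eq, ← mono_add]

theorem par_mono {k : ℕ} (I : Finset (Fin k)) (φ : Fn k) (b) : par I φ (mono b) = φ (mono (indE I + 2 • b)) := by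
  rw [par_apply, XI_mono_sq]

theorem par_ext {k : ℕ} {φ ψ : Fn k} (h : ∀ I, par I φ = par I ψ) : φ = ψ := by
  apply Fn_ext; intro a
  rw [mono_split]
  exact congrArg (fun g => g (mono (halfE a))) (h (oddS a))

def mk {k : ℕ} (ψ : Finset (Fin k) → Fn k) : Fn k := ofM fun a => ψ (oddS a) (mono (halfE a))
theorem par_mk {k : ℕ} (ψ : Finset (Fin k) → Fn k) (I) : par I (mk ψ) = ψ I := by
  apply Fn_ext; intro b
  rw [par_mono, mk, ofM_mono, oddS_eq, halfE_eq]

theorem par_Sup {k d e : ℕ} {φ : Fn k} (h : Sup d φ) {I : Finset (Fin k)} (hd : d = I.card + 2 * e) :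
    Sup e (par I φ) := by
  intro b hb
  rw [par_mono]
  apply h
  rw [degA_add, degA_two, degA_indE]; omega

theorem par_zero_parity {k d : ℕ} {φ : Fn k} (h : Sup d φ) {I : Finset (Fin k)} (hd : ∀ e, d ≠ I.card + 2 * e) :
    par I φ = 0 := by
  apply Fn_ext; intro b
  rw [par_mono]
  apply h
  rw [degA_add, degA_two, degA_indE]; exact (hd _).symm

theorem Sup_of_par {k d : ℕ} {φ : Fn k} (h : ∀ I e, I.card + 2 * e ≠ d → ∀ b, degA b = e → par I φ (mono b) = 0) :
    Sup d φ := by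
  intro a ha
  rw [exp_split a, ← par_mono]
  apply h _ (degA (halfE a)) _ _ rfl
  rwa [exp_split a, degA_add, degA_two, degA_indE] at ha

theorem SqT_XI_sq {k : ℕ} (I : Finset (Fin k)) (f : P k) :
    SqT k (XI I * f ^ 2) = ∑ B ∈ I.powerset, XI (I \ B) * (XI B * SqT k f) ^ 2 := by
  rw [map_mul, map_pow, XI, map_prod]
  simp_rw [SqT_X]
  simp_rw [add_comm (X _ : P k) (X _ ^ 2)]
  rw [Finset.prod_add, Finset.sum_mul]
  refine Finset.sum_congr rfl fun B hB => ?_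
  rw [Finset.prod_pow, XI, XI]; ring

def stL {k : ℕ} (φ : Fn k) (I : Finset (Fin k)) (f : P k) : ZMod 2 :=
  ∑ B ∈ I.powerset, par (I \ B) φ (XI B * SqT k f)

theorem stL_eq {k : ℕ} (φ : Fn k) (I : Finset (Fin k)) (f : P k) :
    stL φ I f = φ (SqT k (XI I * f ^ 2)) := by
  rw [SqT_XI_sq, map_sum]; rfl

theorem star_iff {k : ℕ} (φ : Fn k) : (∀ f, φ (SqT k f) = φ f) ↔ ∀ I f, stL φ I f = par I φ f := by
  constructor
  · intro h I f; rw [stL_eq, h]; rfl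
  · intro h
    have : φ ∘ₗ (SqT k).toLinearMap = φ := by
      apply Fn_ext; intro a
      have := h (oddS a) (mono (halfE a))
      rw [stL_eq] at this
      rw [mono_split]; exact this
    intro f
    exact congrArg (fun g => g f) this

theorem SqT_mono_top {k : ℕ} (a : Fin k →₀ ℕ) : SqT k (mono a) - mono a ^ 2 ∈ Sp k (Set.Iio (2 * degA a)) := by
  induction a using exp_ind with
  | h0 => simp [mono_zero]
  | h1 i =>
    rw [mono_single, SqT_X, add_sub_cancel_right, degA_single]
    exact Sp_mono (by simp) (X_mem_Sp i)
  | hadd a b ha hb =>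
    have e : SqT k (mono (a + b)) - mono (a + b) ^ 2 = mono a ^ 2 * (SqT k (mono b) - mono b ^ 2)
      + (SqT k (mono a) - mono a ^ 2) * mono b ^ 2 + (SqT k (mono a) - mono a ^ 2) * (SqT k (mono b) - mono b ^ 2) := by
      rw [mono_add, map_mul]; ring
    rw [e, degA_add]
    have hma := mono_mem_Sp (k := k) (s := {2 * degA a}) (a := 2 • a) (degA_two a)
    have hmb := mono_mem_Sp (k := k) (s := {2 * degA b}) (a := 2 • b) (degA_two b)
    rw [← mono_sq] at hma hmb
    refine add_mem (add_mem (mul_mem_Sp ?_ hma hb) (mul_mem_Sp ?_ ha hmb)) (mul_mem_Sp ?_ ha hb) <;>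
    · intro x hx y hy; simp at *; omega

def powSum : ℕ → Set ℕ
  | 0 => {0}
  | w + 1 => {m | ∃ j, ∃ m' ∈ powSum w, m = 2 ^ j + m'}

def cI {k : ℕ} (N : ℕ) (I : Finset (Fin k)) : P k := ∏ i ∈ I, ∑ j ∈ Finset.range N, X i ^ 2 ^ j

theorem X_pow_mem {k : ℕ} (i : Fin k) (n : ℕ) : (X i ^ n : P k) ∈ Sp k {n} := by
  have : (X i ^ n : P k) = mono (Finsupp.single i n) := by
    rw [mono, X_pow_eq_monomial]
  rw [this]; exact mono_mem_Sp (by simp [degA_single])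

theorem cI_mem {k : ℕ} (N : ℕ) (I : Finset (Fin k)) : cI N I ∈ Sp k (powSum I.card) := by
  classical
  induction I using Finset.induction_on with
  | empty => simp [cI]; rw [← mono_zero]; exact mono_mem_Sp (by simp [degA_zero, powSum])
  | insert i I hi ih =>
    rw [cI, Finset.prod_insert hi, Finset.sum_mul, Finset.card_insert_of_notMem hi]
    refine sum_mem fun j _ => mul_mem_Sp ?_ (X_pow_mem i (2 ^ j)) ih
    intro x hx y hy; simp at hx; subst hx; exact ⟨j, y, hy, rfl⟩

theorem SqT_c1 {k : ℕ} (N : ℕ) (i : Fin k) : SqT k (∑ j ∈ Finset.range N, X i ^ 2 ^ j) = X i + X i ^ 2 ^ N := by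
  induction N with
  | zero => simp [two_P]
  | succ N ih =>
    rw [Finset.sum_range_succ, map_add, ih, map_pow, SqT_X, add_pow_char_pow, ← pow_mul, ← pow_succ',
      add_assoc, ← add_assoc (X i ^ 2 ^ N), two_P, zero_add]

theorem Sp_univ {k : ℕ} (f : P k) : f ∈ Sp k Set.univ := by
  rw [f.as_sum]
  refine sum_mem fun a ha => ?_
  have h2 : monomial a (coeff a f) = coeff a f • (mono a : P k) := by simp [mono, smul_monomial]
  rw [h2]; exact Submodule.smul_mem _ _ (mono_mem_Sp (by simp))

theorem SqT_cI {k : ℕ} {N n : ℕ} (hN : n < 2 ^ N) (I : Finset (Fin k)) : SqT k (cI N I) - XI I ∈ Sp k (Set.Ioi n) := by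
  classical
  induction I using Finset.induction_on with
  | empty => simp [cI, XI]
  | insert i I hi ih =>
    rw [cI, Finset.prod_insert hi, XI, Finset.prod_insert hi, map_mul, SqT_c1]
    have : (X i + X i ^ 2 ^ N) * SqT k (cI N I) - X i * XI I = X i * (SqT k (cI N I) - XI I) + X i ^ 2 ^ N * SqT k (cI N I) := by ring
    rw [cI, XI] at this
    rw [this]
    refine add_mem (mul_mem_Sp ?_ (Sp_univ _) ih) (mul_mem_Sp ?_ (X_pow_mem i _) (Sp_univ _))
    · intro x hx y hy; simp at *; omega
    · intro x hx y hy; simp at *; omega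

/-- Lemma V -/
theorem vanish {k n e : ℕ} {φ : Fn k} (h : φ ∈ K k n) (I : Finset (Fin k)) (hn : I.card + 2 * e = n)
    (hp : I.card + e ∉ powSum I.card) : par I φ = 0 := by
  apply Fn_ext; intro b
  rw [LinearMap.zero_apply]
  by_cases hb : degA b = e
  swap
  · exact par_Sup h.1 hn.symm b hb
  rw [par_apply]
  have hXI : XI I ∈ Sp k {I.card} := by rw [XI_eq]; exact mono_mem_Sp (degA_indE I)
  have h1 : φ (XI I * (SqT k (mono b) - mono b ^ 2)) = 0 := by
    refine h.1.eq_zero (s := Set.Iio n) (by simp) (mul_mem_Sp ?_ hXI (SqT_mono_top b))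
    intro x hx y hy; simp at *; omega
  have h2 : φ ((SqT k (cI n I) - XI I) * SqT k (mono b)) = 0 := by
    refine h.1.eq_zero (s := Set.Ioi n) (by simp) (mul_mem_Sp ?_ (SqT_cI Nat.lt_two_pow_self I) (Sp_univ _))
    intro x hx y hy; simp at *; omega
  have h3 : φ (cI n I * mono b) = 0 := by
    refine h.1.eq_zero (s := {m | ∃ x ∈ powSum I.card, m = x + e}) ?_ (mul_mem_Sp ?_ (cI_mem n I) (mono_mem_Sp (s := {e}) hb))
    · rintro ⟨x, hx, hx'⟩
      apply hp
      rwa [show I.card + e = x by omega]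
    · intro x hx y hy; simp at hy; subst hy; exact ⟨x, hx, rfl⟩
  rw [← h.2, map_mul] at h3
  rw [mul_sub, map_sub, sub_eq_zero] at h1
  rw [sub_mul, map_sub, sub_eq_zero] at h2
  rw [← h1, ← h2, h3]
end

section
def NN : ℕ → ℕ
  | 0 => 23
  | s + 1 => 2 * NN s + 5

theorem NN_eq (s : ℕ) : NN s + 5 = 28 * 2 ^ s := by
  induction s with
  | zero => rfl
  | succ s ih => rw [NN, pow_succ]; omega

theorem NN_pos (s : ℕ) : 23 ≤ NN s := by
  induction s with
  | zero => exact le_rfl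
  | succ s ih => rw [NN]; omega

theorem not_pow1 (s : ℕ) : NN s + 3 ∉ powSum 1 := by
  rintro ⟨j, m, hm, h⟩
  simp [powSum] at hm; subst hm
  have := NN_eq s
  have h2 : 0 < 2 ^ s := by positivity
  rcases j with _ | _ | j
  · simp at h
  · simp at h
  · rw [pow_succ, pow_succ] at h; omega

theorem not_pow3 (s : ℕ) : NN s + 4 ∉ powSum 3 := by
  rintro ⟨a, m, ⟨b, m', ⟨c, m'', hm, rfl⟩, rfl⟩, h⟩
  simp [powSum] at hm; subst hm
  have := NN_eq s
  have key : ∀ c, 7 * 2 ^ s ≠ 2 ^ c + 1 := by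
    intro c h
    rcases s with _ | s
    · rcases c with _ | _ | c
      · simp at h
      · simp at h
      · rw [pow_succ, pow_succ] at h; omega
    · rcases c with _ | c
      · rw [pow_succ] at h; omega
      · rw [pow_succ, pow_succ] at h; omega
  have h2 : 0 < 2 ^ s := by positivity
  have key2 : ∀ a b, 14 * 2 ^ s ≠ 2 ^ a + 2 ^ b + 1 := by
    intro a b h
    rcases a with _ | a <;> rcases b with _ | b
    · simp at h; omega
    · exact key b (by rw [pow_succ] at h; omega)
    · exact key a (by rw [pow_succ] at h; omega)
    · rw [pow_succ, pow_succ] at h; omega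
  rcases a with _ | a <;> rcases b with _ | b <;> rcases c with _ | c
  · simp at h
  · simp [pow_succ] at h; omega
  · simp [pow_succ] at h; omega
  · exact key2 b c (by simp [pow_succ] at h; omega)
  · simp [pow_succ] at h; omega
  · exact key2 a c (by simp [pow_succ] at h; omega)
  · exact key2 a b (by simp [pow_succ] at h; omega)
  · simp [pow_succ] at h; omega

def F5 (φ : Fn 6) : Prop := ∀ I : Finset (Fin 6), I.card ≠ 5 → par I φ = 0

theorem K_F5 {s : ℕ} {φ : Fn 6} (h : φ ∈ K 6 (NN (s + 1))) : F5 φ := by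
  intro I hI
  have hc : I.card ≤ 6 := by simpa using Finset.card_le_univ I
  have hN : NN (s + 1) = 2 * NN s + 5 := rfl
  by_cases h1 : I.card = 1
  · exact vanish (e := NN s + 2) h I (by omega) (by rw [h1, show 1 + (NN s + 2) = NN s + 3 by omega]; exact not_pow1 s)
  by_cases h3 : I.card = 3
  · exact vanish (e := NN s + 1) h I (by omega) (by rw [h3, show 3 + (NN s + 1) = NN s + 4 by omega]; exact not_pow3 s)
  exact par_zero_parity h.1 (by intro e; omega)

def κ (i : Fin 6) : Fn 6 →ₗ[ZMod 2] Fn 6 := par (Finset.univ.erase i)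

theorem card5 {I : Finset (Fin 6)} (h : I.card = 5) : ∃ i, I = Finset.univ.erase i := by
  have hc : Iᶜ.card = 1 := by rw [Finset.card_compl, h]; rfl
  obtain ⟨i, hi⟩ := Finset.card_eq_one.1 hc
  refine ⟨i, ?_⟩
  rw [← compl_compl I, hi]; ext x; simp

theorem card6 {I : Finset (Fin 6)} (h : I.card = 6) : I = Finset.univ :=
  (Finset.card_eq_iff_eq_univ I).1 (by simpa using h)

theorem F5_ext {φ ψ : Fn 6} (h1 : F5 φ) (h2 : F5 ψ) (h : ∀ i, κ i φ = κ i ψ) : φ = ψ := by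
  apply par_ext; intro I
  by_cases hI : I.card = 5
  · obtain ⟨i, rfl⟩ := card5 hI; exact h i
  · rw [h1 I hI, h2 I hI]

theorem F5_Sq {φ : Fn 6} (h : F5 φ) : (∀ f, φ (SqT 6 f) = φ f) ↔
    (∀ i f, κ i φ (SqT 6 f) = κ i φ f) ∧ ∀ f, ∑ i, κ i φ (X i * SqT 6 f) = 0 := by
  rw [star_iff]
  have e1 : ∀ i f, stL φ (Finset.univ.erase i) f = κ i φ (SqT 6 f) := by
    intro i f
    rw [stL, Finset.sum_eq_single ∅]
    · simp [XI, κ]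
    · intro B hB hne
      rw [h]; · rfl
      have : 0 < B.card := Finset.card_pos.2 (Finset.nonempty_iff_ne_empty.2 hne)
      rw [Finset.card_sdiff_of_subset (Finset.mem_powerset.1 hB)]
      simp; omega
    · intro h; simp at h
  have e2 : ∀ f, stL φ Finset.univ f = ∑ i, κ i φ (X i * SqT 6 f) := by
    intro f
    rw [stL, ← Finset.sum_subset (s₁ := Finset.univ.image fun i : Fin 6 => ({i} : Finset (Fin 6)))]
    · rw [Finset.sum_image (by intro a _ b _ h; simpa using h)]
      refine Finset.sum_congr rfl fun i _ => ?_
      have : (Finset.univ \ {i} : Finset (Fin 6)) = Finset.univ.erase i := by ext x; simp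
      rw [this]; simp [XI, κ]
    · intro x _; simp
    · intro B _ hB
      rw [h]; · rfl
      intro hc
      apply hB
      have : B.card = 1 := by
        rw [Finset.card_sdiff_of_subset (Finset.subset_univ _)] at hc
        have := Finset.card_le_univ B
        simp at hc this; omega
      obtain ⟨i, rfl⟩ := Finset.card_eq_one.1 this
      simp
  constructor
  · intro hs
    refine ⟨fun i f => by rw [← e1, hs]; rfl, fun f => ?_⟩
    rw [← e2, hs, h _ (by simp)]; rfl
  · rintro ⟨h1, h2⟩ I f
    have hc : I.card ≤ 6 := by simpa using Finset.card_le_univ I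
    by_cases h5 : I.card = 5
    · obtain ⟨i, rfl⟩ := card5 h5; rw [e1, h1]; rfl
    by_cases h6 : I.card = 6
    · rw [card6 h6, e2, h2, h _ (by simp)]; rfl
    rw [h I h5, stL]
    refine Finset.sum_eq_zero fun B hB => ?_
    rw [h]; · rfl
    have := Finset.card_le_card (Finset.sdiff_subset (s := I) (t := B))
    omega

theorem cap_Sup {k d : ℕ} {φ : Fn k} (h : Sup (d + 1) φ) (i : Fin k) : Sup d (cap (X i) φ) := by
  intro a ha
  rw [cap_apply, ← mono_single, ← mono_add]
  apply h; rw [degA_add, degA_single]; omega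

theorem Sup.sum {k d : ℕ} {ι : Type*} {s : Finset ι} {φ : ι → Fn k} (h : ∀ i ∈ s, Sup d (φ i)) : Sup d (∑ i ∈ s, φ i) := by
  intro a ha
  rw [LinearMap.sum_apply]
  exact Finset.sum_eq_zero fun i hi => h i hi a ha

theorem κ_K {s : ℕ} {φ : Fn 6} (h : φ ∈ K 6 (NN (s + 1))) (i) : κ i φ ∈ K 6 (NN s) :=
  ⟨par_Sup h.1 (by simp [NN]; omega), ((F5_Sq (K_F5 h)).1 h.2).1 i⟩

theorem κ_sum {s : ℕ} {φ : Fn 6} (h : φ ∈ K 6 (NN (s + 1))) : ∑ i, cap (X i) (κ i φ) = 0 := by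
  have hp := NN_pos s
  refine Sup.Z (d := NN s - 1) (Sup.sum fun i _ => cap_Sup ?_ i) ?_
  · rw [show NN s - 1 + 1 = NN s by omega]; exact (κ_K h i).1
  · intro f
    rw [LinearMap.sum_apply]
    exact ((F5_Sq (K_F5 h)).1 h.2).2 f

/-- multiplication of `X_J f^2` by `x_m` -/
theorem X_mul_notMem {k : ℕ} {m : Fin k} {J : Finset (Fin k)} (h : m ∉ J) (f : P k) :
    X m * (XI J * f ^ 2) = XI (insert m J) * f ^ 2 := by
  rw [XI, XI, Finset.prod_insert h]; ring
theorem X_mul_mem {k : ℕ} {m : Fin k} {J : Finset (Fin k)} (h : m ∈ J) (f : P k) :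
    X m * (XI J * f ^ 2) = XI (J.erase m) * (X m * f) ^ 2 := by
  rw [XI, XI, ← Finset.mul_prod_erase J _ h]; ring

theorem capX_par {m : Fin 6} (φ : Fn 6) (J : Finset (Fin 6)) :
    par J (cap (X m) φ) = if m ∈ J then cap (X m) (par (J.erase m) φ) else par (insert m J) φ := by
  apply LinearMap.ext; intro f
  rw [par_apply, cap_apply]
  split_ifs with h
  · rw [X_mul_mem h]; rfl
  · rw [X_mul_notMem h]; rfl

theorem par_univ_cap (φ : Fn 6) (m : Fin 6) : par Finset.univ (cap (X m) φ) = cap (X m) (κ m φ) := by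
  rw [capX_par, if_pos (Finset.mem_univ _)]; rfl

theorem par4_cap {φ : Fn 6} (h : F5 φ) {i l : Fin 6} (hil : i ≠ l) (m : Fin 6) :
    par ((Finset.univ.erase i).erase l) (cap (X m) φ) =
      if m = i then κ l φ else if m = l then κ i φ else 0 := by
  rw [capX_par]
  split_ifs with h1 h2 h3 h2 h3
  · simp [h2] at h1
  · simp [h3] at h1
  · rw [h, map_zero]
    rw [Finset.card_erase_of_mem h1, Finset.card_erase_of_mem (by simp [hil.symm])]; simp
  · subst h2; rw [κ]; congr 2; ext x; simp; grind
  · subst h3; rw [κ]; congr 2; ext x; simp; grind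
  · exfalso; apply h1; simp [h2, h3]

theorem lemA1 {φ : Fin 6 → Fn 6} (h : ∀ i, F5 (φ i)) (hs : ∑ i, cap (X i) (φ i) = 0) {i l : Fin 6} (hil : i ≠ l) :
    κ l (φ i) = κ i (φ l) := by
  have h1 := congrArg (par ((Finset.univ.erase i).erase l)) hs
  rw [map_sum, map_zero, Finset.sum_congr rfl (fun m _ => par4_cap (h m) hil m)] at h1
  have h2 : ∀ m, (if m = i then κ l (φ m) else if m = l then κ i (φ m) else 0) = 
     (if m = i then κ l (φ i) else 0) + if m = l then κ i (φ l) else 0 := by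
    intro m
    by_cases hm : m = i
    · subst hm; simp [hil]
    · by_cases hm2 : m = l
      · subst hm2; simp [hm]
      · simp [hm, hm2]
  simp_rw [h2] at h1
  rw [Finset.sum_add_distrib, Finset.sum_ite_eq' , Finset.sum_ite_eq'] at h1
  simp only [Finset.mem_univ, if_true] at h1
  have h3 : κ i (φ l) + κ i (φ l) = 0 := by
    apply LinearMap.ext; intro f; exact CharTwo.add_self_eq_zero _
  exact add_right_cancel (h1.trans h3.symm)

theorem lemA2 {φ : Fin 6 → Fn 6} (hs : ∑ i, cap (X i) (φ i) = 0) :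
    ∑ i, cap (X i) (κ i (φ i)) = 0 := by
  have h1 := congrArg (par Finset.univ) hs
  rwa [map_sum, map_zero, Finset.sum_congr rfl (fun m _ => par_univ_cap (φ m) m)] at h1

theorem κ_comm {s : ℕ} {φ : Fn 6} (h : φ ∈ K 6 (NN (s + 2))) (i l) : κ l (κ i φ) = κ i (κ l φ) := by
  by_cases hil : i = l
  · rw [hil]
  · exact lemA1 (fun i => K_F5 (κ_K h i)) (κ_sum h) hil

theorem κ_aab {s : ℕ} {φ : Fn 6} (h : φ ∈ K 6 (NN (s + 3))) (i l) : κ l (κ i (κ i φ)) = κ i (κ l (κ l φ)) := by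
  by_cases hil : i = l
  · rw [hil]
  · exact lemA1 (φ := fun i => κ i (κ i φ)) (fun i => K_F5 (κ_K (κ_K h i) i)) (lemA2 (κ_sum h)) hil

def TT (φ : Fn 6) (w : List (Fin 6)) : Fn 6 := w.foldl (fun φ i => κ i φ) φ
theorem TT_cons (φ) (i) (w) : TT φ (i :: w) = TT (κ i φ) w := rfl
theorem TT_nil (φ) : TT φ [] = φ := rfl
theorem TT_append (φ) (u w) : TT φ (u ++ w) = TT (TT φ u) w := by simp [TT]
theorem TT_add (φ ψ) (w) : TT (φ + ψ) w = TT φ w + TT ψ w := by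
  induction w generalizing φ ψ with
  | nil => rfl
  | cons i w ih => rw [TT_cons, map_add, ih]; rfl
theorem TT_zero (w) : TT 0 w = 0 := by
  induction w with
  | nil => rfl
  | cons i w ih => rw [TT_cons, map_zero, ih]
def TTL (w : List (Fin 6)) : Fn 6 →ₗ[ZMod 2] Fn 6 :=
  AddMonoidHom.toZModLinearMap 2 { toFun := fun φ => TT φ w, map_zero' := TT_zero w, map_add' := fun a b => TT_add a b w }
theorem TTL_apply (w φ) : TTL w φ = TT φ w := rfl

theorem TT_K {s : ℕ} {w : List (Fin 6)} {φ : Fn 6} (h : φ ∈ K 6 (NN (s + w.length))) : TT φ w ∈ K 6 (NN s) := by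
  induction w generalizing φ with
  | nil => exact h
  | cons i w ih => exact ih (κ_K h i)

theorem TT_perm {w w' : List (Fin 6)} (hw : w.Perm w') {s : ℕ} {φ : Fn 6} (h : φ ∈ K 6 (NN (s + w.length))) :
    TT φ w = TT φ w' := by
  induction hw generalizing φ with
  | nil => rfl
  | cons i _ ih => exact ih (κ_K h i)
  | swap i j l => rw [TT_cons, TT_cons, TT_cons, TT_cons, κ_comm (s := s + l.length) h]
  | trans h1 _ ih1 ih2 => rw [ih1 h, ih2 (by rwa [← h1.length_eq])]

theorem TT_dup {w : List (Fin 6)} (h : ¬ w.Nodup) : ∃ a u, w.Perm (a :: a :: u) := by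
  obtain ⟨a, ha⟩ : ∃ a, List.Duplicate a w := by simpa [List.nodup_iff_forall_not_duplicate] using h
  have h1 : 2 ≤ w.count a := List.duplicate_iff_two_le_count.1 ha
  have m1 : a ∈ w := List.count_pos_iff.1 (by omega)
  have m2 : a ∈ w.erase a := List.count_pos_iff.1 (by rw [List.count_erase_self]; omega)
  exact ⟨a, (w.erase a).erase a, (List.perm_cons_erase m1).trans ((List.perm_cons_erase m2).cons a)⟩

theorem TT_supp {s n : ℕ} : ∀ {w w' : List (Fin 6)} {φ : Fn 6} (_ : φ ∈ K 6 (NN (s + n))) (_ : w.length = n)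
    (_ : w'.length = n) (_ : w.toFinset = w'.toFinset), TT φ w = TT φ w' := by
  induction n with
  | zero => intro w w' φ h h1 h2 _; rw [List.length_eq_zero_iff.1 h1, List.length_eq_zero_iff.1 h2]
  | succ n ih =>
    intro w w' φ h h1 h2 h3
    by_cases hd : w.Nodup
    · have hd' : w'.Nodup := by
        rw [← Multiset.coe_nodup, ← Multiset.toFinset_card_eq_card_iff_nodup]
        have := List.toFinset_card_of_nodup hd
        change w'.toFinset.card = w'.length
        rw [← h3, this, h1, h2]
      exact TT_perm ((List.toFinset_eq_iff_perm_dedup.1 h3).trans (by rw [hd'.dedup]) |> fun p => by rwa [hd.dedup] at p) (s := s) (by rwa [h1])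
    · have hd' : ¬ w'.Nodup := by
        intro hd'
        apply hd
        rw [← Multiset.coe_nodup, ← Multiset.toFinset_card_eq_card_iff_nodup]
        have := List.toFinset_card_of_nodup hd'
        change w.toFinset.card = w.length
        rw [h3, this, h1, h2]
      obtain ⟨a, u, hu⟩ := TT_dup hd
      obtain ⟨b, v, hv⟩ := TT_dup hd'
      rw [TT_perm hu (s := s) (by rwa [h1]), TT_perm hv (s := s) (by rwa [h2])]
      have hu1 := hu.length_eq
      have hv1 := hv.length_eq
      rw [List.toFinset_eq_of_perm _ _ hu, List.toFinset_eq_of_perm _ _ hv] at h3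
      simp only [List.length_cons] at hu1 hv1
      by_cases hab : a = b
      · subst hab
        change TT (κ a φ) (a :: u) = TT (κ a φ) (a :: v)
        exact ih (κ_K h a) (by simp; omega) (by simp; omega) (by simpa using h3)
      · have hb : b ∈ u := by
          have : b ∈ (a :: a :: u).toFinset := by rw [h3]; simp
          simpa [Ne.symm hab] using this
        have hp := List.perm_cons_erase hb
        have hl := hp.length_eq
        simp only [List.length_cons] at hl
        rw [TT_perm ((hp.cons a).cons a) (s := s) (by simp only [List.length_cons]; rwa [← hu1, h1])]
        have e : TT φ (a :: a :: b :: u.erase b) = TT φ (b :: b :: a :: u.erase b) := by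
          simp only [TT_cons]
          rw [κ_aab (s := s + (n - 2))]
          rwa [show s + (n - 2) + 3 = s + (n + 1) by omega]
        rw [e]
        change TT (κ b φ) (b :: a :: u.erase b) = TT (κ b φ) (b :: v)
        refine ih (κ_K h b) (by simp; omega) (by simp; omega) ?_
        rw [List.toFinset_eq_of_perm _ _ ((hp.cons a).cons a)] at h3
        simp only [List.toFinset_cons] at h3 ⊢
        rw [Finset.insert_idem] at h3
        rw [Finset.insert_comm, h3, Finset.insert_idem]

theorem TT_rep {s : ℕ} {φ : Fn 6} (j : ℕ) (h : φ ∈ K 6 (NN (s + j + 1))) :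
    ∑ l, cap (X l) (TT φ (List.replicate (j + 1) l)) = 0 := by
  induction j generalizing s with
  | zero => simpa [TT] using κ_sum h
  | succ j ih =>
    have h1 := lemA2 (ih (s := s + 1) (by rwa [show s + 1 + j + 1 = s + (j + 1) + 1 by omega]))
    rw [← h1]
    refine Finset.sum_congr rfl fun l _ => ?_
    rw [List.replicate_succ' (n := j + 1), TT_append]; rfl

theorem TT_inj {n : ℕ} {φ : Fn 6} (h : φ ∈ K 6 (NN n)) (h0 : ∀ w : List (Fin 6), w.length = n → TT φ w = 0) : φ = 0 := by
  induction n generalizing φ with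
  | zero => simpa [TT] using h0 [] rfl
  | succ n ih =>
    apply F5_ext (K_F5 h) (by intro I _; simp)
    intro i
    rw [map_zero]
    exact ih (κ_K h i) fun w hw => h0 (i :: w) (by simp [hw])
end

section
theorem fn2 {k : ℕ} (φ : Fn k) : φ + φ = 0 := by
  apply LinearMap.ext; intro f; exact CharTwo.add_self_eq_zero _
theorem fn2' {k : ℕ} {φ ψ : Fn k} (h : φ + ψ = 0) : φ = ψ := add_right_cancel (h.trans (fn2 ψ).symm)
theorem fn_even {k n : ℕ} (hn : Even n) (φ : Fn k) : n • φ = 0 := by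
  obtain ⟨m, rfl⟩ := hn
  rw [← two_mul, mul_comm, mul_smul, two_smul, fn2, smul_zero]

theorem cap_add {k : ℕ} (f g : P k) (φ : Fn k) : cap (f + g) φ = cap f φ + cap g φ := by
  apply LinearMap.ext; intro h; simp [cap_apply, add_mul]
theorem cap_sum {k : ℕ} {ι : Type*} (s : Finset ι) (f : ι → P k) (φ : Fn k) :
    cap (∑ i ∈ s, f i) φ = ∑ i ∈ s, cap (f i) φ := by
  apply LinearMap.ext; intro h; simp [cap_apply, Finset.sum_mul, LinearMap.sum_apply]
theorem cap_mul {k : ℕ} (f g : P k) (φ : Fn k) : cap (f * g) φ = cap f (cap g φ) := by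
  apply LinearMap.ext; intro h; simp only [cap_apply]; congr 1; ring

def LL {k : ℕ} (R : Finset (Fin k)) : P k := ∑ i ∈ R, X i
theorem SqT_LL {k : ℕ} (R : Finset (Fin k)) : SqT k (LL R) = LL R + LL R ^ 2 := by
  have h : LL R ^ 2 = sqL k (LL R) := rfl
  rw [h, LL, map_sum, map_sum, ← Finset.sum_add_distrib]
  exact Finset.sum_congr rfl fun i _ => SqT_X i

theorem cap_sq {k d : ℕ} {z : Fn k} (hz : z ∈ K k d) (R : Finset (Fin k)) (f : P k) :
    cap (LL R) (cap (LL R) z) (SqT k f) = cap (LL R) z f + cap (LL R) z (SqT k f) := by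
  have h1 := hz.2 (LL R * f)
  rw [map_mul, SqT_LL, add_mul, map_add] at h1
  simp only [cap_apply]
  rw [← h1, add_right_comm, CharTwo.add_self_eq_zero, zero_add]
  congr 1; ring

section
variable {T : Finset (Fin 6) → Fn 6}

def zz (T : Finset (Fin 6) → Fn 6) (R : Finset (Fin 6)) : Fn 6 := ∑ S ∈ Finset.univ.filter (R ⊆ ·), T S
def UU (T : Finset (Fin 6) → Fn 6) (S : Finset (Fin 6)) : Fn 6 := ∑ l, cap (X l) (T (insert l S))
def uu (T : Finset (Fin 6) → Fn 6) (i : Fin 6) : Fn 6 := UU T (Finset.univ.erase i)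

theorem zz_cap (R : Finset (Fin 6)) : ∑ S ∈ Finset.univ.filter (R ⊆ ·), UU T S = cap (LL R) (zz T R) := by
  simp only [UU]
  rw [Finset.sum_comm, LL, cap_sum, ← Finset.sum_subset (Finset.subset_univ R)]
  · refine Finset.sum_congr rfl fun l hl => ?_
    rw [zz, map_sum]
    refine Finset.sum_congr rfl fun S hS => ?_
    rw [Finset.insert_eq_of_mem ((Finset.mem_filter.1 hS).2 hl)]
  · intro l _ hl
    refine Finset.sum_involution (fun S _ => if l ∈ S then S.erase l else insert l S) ?_ ?_ ?_ ?_
    · intro S hS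
      split_ifs with h
      · rw [Finset.insert_erase h, Finset.insert_eq_of_mem h, fn2]
      · rw [Finset.insert_idem, fn2]
    · intro S hS _ he
      split_ifs at he with h
      · rw [← he] at h; simp at h
      · apply h; rw [← he]; simp
    · intro S hS
      simp only [Finset.mem_filter, Finset.mem_univ, true_and] at hS ⊢
      split_ifs with h
      · exact fun x hx => Finset.mem_erase.2 ⟨fun e => hl (e ▸ hx), hS hx⟩
      · exact hS.trans (Finset.subset_insert _ _)
    · intro S hS
      by_cases h : l ∈ S
      · simp [h]
      · simp [h]

theorem moeb (S : Finset (Fin 6)) : ∑ R ∈ Finset.univ.filter (S ⊆ ·), zz T R = T S := by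
  simp only [zz]
  rw [Finset.sum_comm' (t' := Finset.univ.filter (S ⊆ ·)) (s' := fun S' => Finset.Icc S S')]
  · rw [Finset.sum_eq_single S]
    · simp
    · intro S' h1 h2
      rw [Finset.sum_const]
      apply fn_even
      have h3 : S ⊆ S' := by simpa using h1
      rw [Finset.card_Icc_finset h3]
      have := Finset.card_lt_card (Finset.ssubset_iff_subset_ne.2 ⟨h3, Ne.symm h2⟩)
      exact (Nat.even_pow).2 ⟨even_two, by omega⟩
    · intro h; simp at h
  · intro R S'
    simp only [Finset.mem_filter, Finset.mem_univ, true_and, Finset.mem_Icc]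
    constructor
    · rintro ⟨a, b⟩; exact ⟨⟨a, b⟩, a.trans b⟩
    · rintro ⟨⟨a, b⟩, _⟩; exact ⟨a, b⟩

variable (hT1 : T Finset.univ = 0) (hK : ∀ S, T S ∈ K 6 23) (hS : ∀ S, S.card ≤ 4 → UU T S = 0)
include hT1 hS in
theorem zz_u0 (R : Finset (Fin 6)) : cap (LL R) (zz T R) = ∑ i ∈ Rᶜ, uu T i := by
  rw [← zz_cap]
  have hinj : ∀ a ∈ Rᶜ, ∀ b ∈ Rᶜ, Finset.univ.erase a = Finset.univ.erase b → a = b := by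
    intro a _ b _ h
    by_contra hne
    have : a ∈ Finset.univ.erase b := by simp [hne]
    rw [← h] at this; simp at this
  have : ∑ i ∈ Rᶜ, uu T i = ∑ S ∈ Rᶜ.image (fun i => Finset.univ.erase i), UU T S := by
    rw [Finset.sum_image hinj]; rfl
  rw [this]
  symm
  apply Finset.sum_subset
  · intro S hS
    simp only [Finset.mem_image, Finset.mem_compl] at hS
    obtain ⟨i, hi, rfl⟩ := hS
    simp only [Finset.mem_filter, Finset.mem_univ, true_and]
    exact fun x hx => by simp; rintro rfl; exact hi hx
  · intro S h1 h2
    have h1 : R ⊆ S := by simpa using h1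
    have hc : S.card ≤ 6 := by simpa using Finset.card_le_univ S
    by_cases h5 : S.card = 5
    · obtain ⟨i, rfl⟩ := card5 h5
      exfalso; apply h2
      rw [Finset.mem_image]
      exact ⟨i, by simp; intro h; simpa using h1 h, rfl⟩
    by_cases h6 : S.card = 6
    · rw [card6 h6, UU]
      refine Finset.sum_eq_zero fun l _ => ?_
      rw [Finset.insert_eq_of_mem (Finset.mem_univ _), hT1, map_zero]
    exact hS _ (by omega)

include hT1 hS in
theorem zz_u (R : Finset (Fin 6)) : cap (LL R) (zz T R) = ∑ i ∈ R, uu T i := by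
  have h0 := zz_u0 hT1 hS ∅
  have e : cap (LL ∅) (zz T ∅) = 0 := by
    apply LinearMap.ext; intro f; simp [LL, cap_apply]
  rw [e, Finset.compl_empty, ← Finset.sum_add_sum_compl R] at h0
  rw [zz_u0 hT1 hS R]
  exact (fn2' h0.symm).symm

include hK in
theorem zz_K (R) : zz T R ∈ K 6 23 := sum_mem fun S _ => hK S
include hK in
theorem UU_Sup (S) : Sup 22 (UU T S) := Sup.sum fun l _ => cap_Sup (hK _).1 l

include hT1 hS hK in
theorem uu_sq (R : Finset (Fin 6)) (f) : cap (LL R) (∑ i ∈ R, uu T i) (SqT 6 f) = (∑ i ∈ R, uu T i) f + (∑ i ∈ R, uu T i) (SqT 6 f) := by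
  rw [← zz_u hT1 hS R]
  exact cap_sq (zz_K hK R) R f

theorem LL_single {k : ℕ} (i : Fin k) : LL {i} = X i := by simp [LL]
theorem LL_pair {k : ℕ} {i j : Fin k} (h : i ≠ j) : LL {i, j} = X i + X j := by rw [LL, Finset.sum_pair h]

include hT1 hS hK in
theorem uu_symm (i j : Fin 6) : cap (X i) (uu T j) = cap (X j) (uu T i) := by
  by_cases hij : i = j
  · rw [hij]
  have hs : ∀ i, Sup 22 (uu T i) := fun i => UU_Sup hK _
  apply fn2'
  apply Sup.Z (d := 21)
  · intro a ha
    rw [LinearMap.add_apply, cap_Sup (hs j) i a ha, cap_Sup (hs i) j a ha]; rfl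
  · intro f
    have h1 := uu_sq hT1 hK hS {i} f
    have h2 := uu_sq hT1 hK hS {j} f
    have h3 := uu_sq hT1 hK hS {i, j} f
    rw [LL_pair hij, Finset.sum_pair hij, cap_add, map_add, map_add] at h3
    rw [LL_single, Finset.sum_singleton] at h1 h2
    simp only [LinearMap.add_apply] at h3 ⊢
    rw [h1, h2] at h3
    generalize (cap (X i)) (uu T j) ((SqT 6) f) = a1 at *
    generalize (cap (X j)) (uu T i) ((SqT 6) f) = a2 at *
    generalize (uu T i) f = a3 at *
    generalize (uu T j) f = a4 at *
    generalize (uu T i) ((SqT 6) f) = a5 at *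
    generalize (uu T j) ((SqT 6) f) = a6 at *
    clear h1 h2
    revert a1 a2 a3 a4 a5 a6; decide

open Classical in
def tt (T : Finset (Fin 6) → Fn 6) : Fn 6 := ofM fun a =>
  if h : ∃ i, a i ≠ 0 then uu T h.choose (mono (a - Finsupp.single h.choose 1)) else 0

include hT1 hS hK in
theorem tt_cap (i) : cap (X i) (tt T) = uu T i := by
  apply Fn_ext; intro a
  rw [cap_apply, ← mono_single, ← mono_add, tt, ofM_mono]
  have h : ∃ j, (Finsupp.single i 1 + a : Fin 6 →₀ ℕ) j ≠ 0 := ⟨i, by simp⟩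
  rw [dif_pos h]
  have hj := h.choose_spec
  generalize h.choose = j at *
  by_cases hij : j = i
  · subst hij; rw [add_tsub_cancel_left]
  · have hj2 : a j ≠ 0 := by simpa [Ne.symm hij] using hj
    obtain ⟨b, rfl⟩ : ∃ b, a = Finsupp.single j 1 + b := by
      refine ⟨a - Finsupp.single j 1, ?_⟩
      rw [add_tsub_cancel_of_le]
      rw [Finsupp.single_le_iff]; omega
    rw [add_left_comm, add_tsub_cancel_left, mono_add, mono_add, mono_single, mono_single, ← cap_apply, ← cap_apply,
      uu_symm hT1 hK hS]

theorem exp_cases {k : ℕ} (a : Fin k →₀ ℕ) : a = 0 ∨ ∃ i b, a = Finsupp.single i 1 + b := by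
  by_cases h : a = 0
  · exact Or.inl h
  · obtain ⟨i, hi⟩ := Finsupp.ne_iff.1 h
    refine Or.inr ⟨i, a - Finsupp.single i 1, ?_⟩
    rw [add_tsub_cancel_of_le]
    rw [Finsupp.single_le_iff]; simp at hi; omega

theorem tt_zero : tt T (mono 0) = 0 := by
  rw [tt, ofM_mono, dif_neg]; simp

include hT1 hS hK in
theorem tt_K : tt T ∈ K 6 23 := by
  refine ⟨fun a ha => ?_, ?_⟩
  · rcases exp_cases a with rfl | ⟨i, b, rfl⟩
    · exact tt_zero
    · rw [mono_add, mono_single, ← cap_apply, tt_cap hT1 hK hS]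
      apply UU_Sup hK
      rw [degA_add, degA_single] at ha; omega
  · suffices h : tt T ∘ₗ (SqT 6).toLinearMap = tt T from fun f => congrArg (fun g => g f) h
    apply Fn_ext; intro a
    rw [LinearMap.comp_apply, AlgHom.toLinearMap_apply]
    rcases exp_cases a with rfl | ⟨i, b, rfl⟩
    · rw [mono_zero, map_one]
    · have h := uu_sq hT1 hK hS {i} (mono b)
      rw [LL_single, Finset.sum_singleton] at h
      rw [mono_add, mono_single, map_mul, SqT_X, add_mul, map_add, sq, mul_assoc, ← cap_apply, ← cap_apply, ← cap_apply,
        tt_cap hT1 hK hS, h, ← cap_apply, tt_cap hT1 hK hS, add_left_comm, CharTwo.add_self_eq_zero, add_zero]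

include hT1 hS hK in
theorem lemB : ∃ z : Finset (Fin 6) → Fn 6, (∀ R, z R ∈ K 6 23 ∧ cap (LL R) (z R) = 0) ∧
    ∀ S, S.card ≤ 5 → ∑ R ∈ Finset.univ.filter (S ⊆ ·), z R = T S := by
  refine ⟨fun R => zz T R + tt T, fun R => ⟨add_mem (zz_K hK R) (tt_K hT1 hK hS), ?_⟩, fun S hc => ?_⟩
  · rw [map_add, zz_u hT1 hS]
    have : cap (LL R) (tt T) = ∑ i ∈ R, uu T i := by
      rw [LL, cap_sum]; exact Finset.sum_congr rfl fun i _ => tt_cap hT1 hK hS i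
    rw [this, fn2]
  · rw [Finset.sum_add_distrib, moeb, Finset.sum_const, fn_even, add_zero]
    have : Finset.univ.filter (S ⊆ ·) = Finset.Icc S Finset.univ := by ext x; simp
    rw [this, Finset.card_Icc_finset (Finset.subset_univ _)]
    exact (Nat.even_pow).2 ⟨even_two, by simp; omega⟩
end
end

section
open Classical in
def thF (R : Finset (Fin 6)) (z : Fn 6) : Fn 6 := mk fun I => if ∃ i ∈ R, I = Finset.univ.erase i then z else 0
def th (R : Finset (Fin 6)) : Fn 6 →ₗ[ZMod 2] Fn 6 :=
  AddMonoidHom.toZModLinearMap 2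
   { toFun := thF R
     map_zero' := by apply par_ext; intro I; rw [thF, par_mk]; simp
     map_add' := by
      intro a b; apply par_ext; intro I; rw [map_add]; simp only [thF, par_mk]
      split_ifs <;> simp }
open Classical in
theorem par_th (R : Finset (Fin 6)) (z I) : par I (th R z) = if ∃ i ∈ R, I = Finset.univ.erase i then z else 0 := by
  change par I (thF R z) = _
  rw [thF, par_mk]
theorem erase_inj {a b : Fin 6} (h : Finset.univ.erase a = Finset.univ.erase b) : a = b := by
  by_contra hne
  have : a ∈ Finset.univ.erase b := by simp [hne]
  rw [← h] at this; simp at this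
theorem κ_th (R : Finset (Fin 6)) (z) (i) : κ i (th R z) = if i ∈ R then z else 0 := by
  rw [κ, par_th]
  congr 1
  apply propext
  constructor
  · rintro ⟨j, hj, h⟩; rw [erase_inj h]; exact hj
  · intro h; exact ⟨i, h, rfl⟩
theorem F5_th (R : Finset (Fin 6)) (z) : F5 (th R z) := by
  intro I hI
  rw [par_th, if_neg]
  rintro ⟨i, _, rfl⟩
  exact hI (by simp)

theorem card4 {I : Finset (Fin 6)} (h : I.card = 4) : ∃ i l, i ≠ l ∧ I = (Finset.univ.erase i).erase l := by
  have hc : Iᶜ.card = 2 := by rw [Finset.card_compl, h]; rfl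
  obtain ⟨i, l, hil, hi⟩ := Finset.card_eq_two.1 hc
  refine ⟨i, l, hil, ?_⟩
  rw [← compl_compl I, hi]; ext x; simp; tauto

theorem th_K {d : ℕ} {R : Finset (Fin 6)} {z : Fn 6} (hz : z ∈ K 6 d) (hc : cap (LL R) z = 0) :
    th R z ∈ K 6 (2 * d + 5) ∧ cap (LL R) (th R z) = 0 := by
  have hs : ∀ g : Fin 6 → Fn 6, (∑ i, cap (X i) (if i ∈ R then g i else 0)) = ∑ i ∈ R, cap (X i) (g i) := by
    intro g
    rw [← Finset.sum_subset (Finset.subset_univ R)]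
    · exact Finset.sum_congr rfl fun i hi => by rw [if_pos hi]
    · intro i _ hi; rw [if_neg hi, map_zero]
  have hsum : ∑ i ∈ R, cap (X i) z = 0 := by rw [← cap_sum]; exact hc
  refine ⟨⟨Sup_of_par ?_, (F5_Sq (F5_th R z)).2 ⟨?_, ?_⟩⟩, ?_⟩
  · intro I e hI b hb
    rw [par_th]
    split_ifs with h
    · obtain ⟨i, _, rfl⟩ := h
      apply hz.1
      simp at hI; omega
    · rfl
  · intro i f
    rw [κ_th]; split_ifs
    · exact hz.2 f
    · rfl
  · intro f
    have h1 := (hs fun _ => z).trans hsum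
    have h2 := congrArg (fun g => g (SqT 6 f)) h1
    simp only [LinearMap.sum_apply, cap_apply, LinearMap.zero_apply] at h2
    simp only [κ_th]; exact h2
  · apply par_ext; intro J
    rw [LL, cap_sum, map_sum, map_zero]
    by_cases h6 : J.card = 6
    · rw [card6 h6]
      simp only [par_univ_cap]
      rw [← hsum]
      exact Finset.sum_congr rfl fun i hi => by rw [κ_th, if_pos hi]
    by_cases h4 : J.card = 4
    · obtain ⟨i, l, hil, rfl⟩ := card4 h4
      simp only [par4_cap (F5_th R z) hil, κ_th]
      have h2 : ∀ m, (if m = i then (if l ∈ R then z else 0) else if m = l then (if i ∈ R then z else 0) else 0) = 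
         (if m = i then (if l ∈ R then z else 0) else 0) + if m = l then (if i ∈ R then z else 0) else 0 := by
        intro m
        by_cases hm : m = i
        · subst hm; simp [hil]
        · simp [hm]
      simp_rw [h2]
      rw [Finset.sum_add_distrib, Finset.sum_ite_eq', Finset.sum_ite_eq']
      by_cases h1 : i ∈ R <;> by_cases h2 : l ∈ R <;> simp [h1, h2, fn2]
    · refine Finset.sum_eq_zero fun m _ => ?_
      rw [capX_par]
      split_ifs with hm
      · rw [F5_th, map_zero]
        rw [Finset.card_erase_of_mem hm]; omega
      · rw [F5_th]
        rw [Finset.card_insert_of_notMem hm]; omega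

theorem thn_K {R : Finset (Fin 6)} {z : Fn 6} (hz : z ∈ K 6 23) (hc : cap (LL R) z = 0) (n : ℕ) :
    (th R ^ n) z ∈ K 6 (NN n) ∧ cap (LL R) ((th R ^ n) z) = 0 := by
  induction n with
  | zero => exact ⟨hz, hc⟩
  | succ n ih =>
    rw [pow_succ', Module.End.mul_apply, NN]
    exact th_K ih.1 ih.2

theorem TT_thn (R : Finset (Fin 6)) (z : Fn 6) (w : List (Fin 6)) :
    TT ((th R ^ w.length) z) w = if w.toFinset ⊆ R then z else 0 := by
  induction w with
  | nil => simp [TT]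
  | cons i w ih =>
    rw [List.length_cons, pow_succ', TT_cons, Module.End.mul_apply, κ_th]
    split_ifs with h1 h2 h2
    · rw [ih, if_pos]; rw [List.toFinset_cons, Finset.insert_subset_iff] at h2; exact h2.2
    · rw [ih, if_neg]; rw [List.toFinset_cons, Finset.insert_subset_iff] at h2; tauto
    · rw [List.toFinset_cons, Finset.insert_subset_iff] at h2; exact absurd h2.1 h1
    · exact TT_zero w

def HR (R : Finset (Fin 6)) : Submodule (ZMod 2) (Fn 6) := K 6 23 ⊓ LinearMap.ker (cap (LL R))
theorem mem_HR {R z} : z ∈ HR R ↔ z ∈ K 6 23 ∧ cap (LL R) z = 0 := by simp [HR]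

abbrev NF := {R : Finset (Fin 6) // R.Nonempty}
def ThF (n : ℕ) (z : ∀ R : NF, HR R.1) : Fn 6 := ∑ R : NF, (th R.1 ^ n) (z R).1
def Th (n : ℕ) : (∀ R : NF, HR R.1) →ₗ[ZMod 2] K 6 (NN n) where
  toFun z := ⟨ThF n z, sum_mem fun R _ => (thn_K (mem_HR.1 (z R).2).1 (mem_HR.1 (z R).2).2 n).1⟩
  map_add' a b := by
    apply Subtype.ext
    simp only [ThF, Pi.add_apply, Submodule.coe_add, map_add, Finset.sum_add_distrib]
  map_smul' c a := by
    apply Subtype.ext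
    simp only [ThF, Pi.smul_apply, Submodule.coe_smul, map_smul, Finset.smul_sum, RingHom.id_apply]
theorem Th_apply (n z) : (Th n z).1 = ThF n z := rfl

def extz (z : ∀ R : NF, HR R.1) (R : Finset (Fin 6)) : Fn 6 := if h : R.Nonempty then (z ⟨R, h⟩).1 else 0

theorem TT_ThF (z : ∀ R : NF, HR R.1) {w : List (Fin 6)} (hw : w ≠ []) :
    TT (ThF w.length z) w = zz (extz z) w.toFinset := by
  rw [← TTL_apply, ThF, map_sum, zz]
  simp only [TTL_apply, TT_thn]
  have h1 : ∀ R : NF, (if w.toFinset ⊆ R.1 then (z R).1 else 0) = if w.toFinset ⊆ R.1 then extz z R.1 else 0 := by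
    intro R; simp [extz, R.2]
  rw [Finset.sum_congr rfl fun R _ => h1 R,
    ← Finset.sum_subtype (Finset.univ.filter fun R : Finset (Fin 6) => R.Nonempty) (by simp)
      (fun R => if w.toFinset ⊆ R then extz z R else 0), Finset.sum_filter, Finset.sum_filter]
  refine Finset.sum_congr rfl fun R _ => ?_
  by_cases hR : R.Nonempty
  · rw [if_pos hR]
  · rw [if_neg hR, if_neg]
    intro h
    exact hR (Finset.Nonempty.mono h (by simpa using hw))

theorem ex_word {S : Finset (Fin 6)} (h : S.Nonempty) {n : ℕ} (hn : S.card ≤ n) :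
    ∃ w : List (Fin 6), w.length = n ∧ w.toFinset = S := by
  obtain ⟨a, ha⟩ := h
  refine ⟨S.toList ++ List.replicate (n - S.card) a, by simp; omega, ?_⟩
  rw [List.toFinset_append, Finset.toList_toFinset]
  ext x
  simp only [Finset.mem_union, List.mem_toFinset, List.mem_replicate]
  constructor
  · rintro (h | ⟨_, rfl⟩) <;> assumption
  · exact Or.inl

theorem cap_all_zero {y : Fn 6} (hy : y ∈ K 6 23) (h : ∀ i, cap (X i) y = 0) : y = 0 := by
  apply Fn_ext; intro a
  rcases exp_cases a with rfl | ⟨i, b, rfl⟩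
  · exact hy.1 _ (by simp [degA_zero])
  · rw [mono_add, mono_single, ← cap_apply, h]; rfl

theorem Th_ker {n : ℕ} (hn : 5 ≤ n) (z : ∀ R : NF, HR R.1) (h0 : ThF n z = 0) (R : NF) : (z R).1 = 0 := by
  have h1 : ∀ S : Finset (Fin 6), S.Nonempty → S.card ≤ 5 → zz (extz z) S = 0 := by
    intro S hS hc
    obtain ⟨w, hw, rfl⟩ := ex_word hS (hc.trans hn)
    rw [← TT_ThF z (by rintro rfl; simp at hS), hw, h0, TT_zero]
  have h2 : ∀ R : NF, (z R).1 = (z ⟨Finset.univ, Finset.univ_nonempty⟩).1 := by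
    intro R
    have h3 := moeb (T := extz z) R.1
    rw [Finset.sum_eq_single Finset.univ] at h3
    · have h4 : zz (extz z) Finset.univ = extz z Finset.univ := by
        rw [zz, Finset.sum_eq_single Finset.univ]
        · intro S hS hne; simp [Finset.univ_subset_iff] at hS; exact absurd hS hne
        · intro h; simp at h
      rw [h4] at h3
      simp only [extz, R.2, Finset.univ_nonempty, dif_pos] at h3
      exact h3.symm
    · intro S hS hne
      apply h1 S (R.2.mono (by simpa using hS))
      have := Finset.card_lt_univ_of_notMem (s := S) (x := (Finset.nonempty_iff_ne_empty.2 (by simpa [Finset.compl_eq_empty_iff] using hne : Sᶜ ≠ ∅)).choose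
        ) (by simpa using (Finset.nonempty_iff_ne_empty.2 (by simpa using hne : Sᶜ ≠ ∅)).choose_spec)
      simp at this; omega
    · intro h; simp at h
  have h3 : (z ⟨Finset.univ, Finset.univ_nonempty⟩).1 = 0 := by
    apply cap_all_zero (mem_HR.1 (z _).2).1
    intro i
    have := (mem_HR.1 (z ⟨{i}, by simp⟩).2).2
    rwa [h2, LL_single] at this
  rw [h2 R, h3]

theorem Th_inj {n : ℕ} (hn : 5 ≤ n) : Function.Injective (Th n) := by
  intro a b hab
  have h : ThF n (a + b) = 0 := by
    rw [← Th_apply, map_add, hab, Submodule.coe_add, fn2]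
  funext R
  apply Subtype.ext
  exact fn2' (Th_ker hn _ h R)

theorem card_le5 {S : Finset (Fin 6)} (h : S ≠ Finset.univ) : S.card ≤ 5 := by
  have hc : S.card ≤ 6 := by simpa using Finset.card_le_univ S
  by_contra h2
  exact h (card6 (by omega))

open Classical in
def Tf (n : ℕ) (φ : Fn 6) (S : Finset (Fin 6)) : Fn 6 :=
  if h : ∃ w : List (Fin 6), w.length = n ∧ w.toFinset = S ∧ S ≠ Finset.univ then TT φ h.choose else 0

theorem Tf_eq {n : ℕ} {φ : Fn 6} (h : φ ∈ K 6 (NN n)) {w : List (Fin 6)} (hw : w.length = n) (hS : w.toFinset ≠ Finset.univ) :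
    Tf n φ w.toFinset = TT φ w := by
  have he : ∃ w' : List (Fin 6), w'.length = n ∧ w'.toFinset = w.toFinset ∧ w.toFinset ≠ Finset.univ := ⟨w, hw, rfl, hS⟩
  rw [Tf, dif_pos he]
  exact TT_supp (s := 0) (n := n) (by rwa [zero_add]) he.choose_spec.1 hw he.choose_spec.2.1

theorem Th_surj {n : ℕ} (hn : 5 ≤ n) : Function.Surjective (Th n) := by
  rintro ⟨φ, hφ⟩
  have hB := lemB (T := Tf n φ) ?_ ?_ ?_
  · obtain ⟨z, hz1, hz2⟩ := hB
    refine ⟨fun R => ⟨z R.1, mem_HR.2 (hz1 R.1)⟩, ?_⟩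
    set z' : ∀ R : NF, HR R.1 := fun R => ⟨z R.1, mem_HR.2 (hz1 R.1)⟩ with hz'
    apply Subtype.ext
    rw [Th_apply]
    symm
    apply fn2'
    have hK' : φ + ThF n z' ∈ K 6 (NN n) := add_mem hφ (Th n z').2
    have hw0 : ∀ w : List (Fin 6), w.length = n → w.toFinset ≠ Finset.univ → TT (φ + ThF n z') w = 0 := by
      intro w hw hS
      have hne : w ≠ [] := by rintro rfl; simp at hw; omega
      rw [TT_add]
      have h1 := TT_ThF z' hne
      rw [hw] at h1
      rw [h1, ← Tf_eq hφ hw hS, ← hz2 _ (card_le5 hS), zz]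
      rw [← fn2 (∑ R ∈ Finset.univ.filter (w.toFinset ⊆ ·), z R)]
      congr 1
      refine Finset.sum_congr rfl fun R hR => ?_
      have : R.Nonempty := by
        refine Finset.Nonempty.mono (by simpa using hR : w.toFinset ⊆ R) ?_
        simpa using hne
      simp [extz, this, hz']
    generalize φ + ThF n z' = χ at *
    apply TT_inj hK'
    intro w hw
    by_cases hS : w.toFinset = Finset.univ
    · have hn6 : 6 ≤ n := by
        have := List.toFinset_card_le w
        rw [hS, hw] at this; simpa using this
      apply cap_all_zero (TT_K (s := 0) (by rwa [zero_add, hw]))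
      intro l
      obtain ⟨u, hu, hus⟩ := ex_word (S := Finset.univ.erase l) (n := n - 1) (by
        apply Finset.card_pos.1; simp) (by simp; omega)
      have h1 := κ_sum (s := 0) (φ := TT χ u) (TT_K (s := 1) (by rwa [hu, show 1 + (n - 1) = n by omega]))
      have h2 : ∀ i, κ i (TT χ u) = TT χ (u ++ [i]) := by intro i; rw [TT_append]; rfl
      simp only [h2] at h1
      rw [Finset.sum_eq_single l] at h1
      · rw [TT_supp (s := 0) (n := n) (w' := u ++ [l]) (by rwa [zero_add]) hw (by simp; omega), h1]
        rw [hS, List.toFinset_append, hus]; ext x; simp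
      · intro i _ hi
        rw [hw0, map_zero]
        · simp; omega
        · rw [List.toFinset_append, hus]
          intro h
          have : l ∈ Finset.univ.erase l ∪ [i].toFinset := by rw [h]; simp
          simp at this; exact hi this.symm
      · intro h; simp at h
    · exact hw0 w hw hS
  · rw [Tf, dif_neg]; rintro ⟨w, _, _, h⟩; exact h rfl
  · intro S
    rw [Tf]; split_ifs with h
    · exact TT_K (s := 0) (by rwa [zero_add, h.choose_spec.1])
    · exact zero_mem _
  · intro S hS
    rw [UU]
    have key : ∀ (w : Fin 6 → List (Fin 6)), (∀ l, (w l).length = n ∧ (w l).toFinset = insert l S) →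
        ∀ l, Tf n φ (insert l S) = TT φ (w l) := by
      intro w hw l
      rw [← (hw l).2]
      apply Tf_eq hφ (hw l).1
      rw [(hw l).2]
      intro h
      have := Finset.card_insert_le l S
      rw [h] at this; simp at this; omega
    by_cases he : S.Nonempty
    · obtain ⟨u, hu, rfl⟩ := ex_word (n := n - 1) he (by omega)
      rw [← κ_sum (s := 0) (φ := TT φ u) (TT_K (s := 1) (by rwa [hu, show 1 + (n - 1) = n by omega]))]
      refine Finset.sum_congr rfl fun l _ => ?_
      rw [key (fun l => u ++ [l]) _ l, TT_append]
      · rfl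
      · intro l; constructor
        · simp; omega
        · ext x; simp
    · rw [Finset.not_nonempty_iff_eq_empty] at he
      subst he
      rw [← TT_rep (s := 0) (n - 1) (φ := φ) (by rwa [show 0 + (n - 1) + 1 = n by omega])]
      refine Finset.sum_congr rfl fun l _ => ?_
      rw [key (fun l => List.replicate (n - 1 + 1) l) _ l]
      intro l; constructor
      · simp; omega
      · rw [List.toFinset_replicate_of_ne_zero (by omega)]; rfl

theorem finrank_big {n : ℕ} (hn : 5 ≤ n) :
    Module.finrank (ZMod 2) (K 6 (NN n)) = Module.finrank (ZMod 2) (∀ R : NF, HR R.1) :=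
  (LinearEquiv.ofBijective (Th n) ⟨Th_inj hn, Th_surj hn⟩).finrank_eq.symm
end

section
theorem alg_mono_Sp {k l : ℕ} (g : P k →ₐ[ZMod 2] P l) (h : ∀ i, g (X i) ∈ Sp l {1}) (a : Fin k →₀ ℕ) :
    g (mono a) ∈ Sp l {degA a} := by
  induction a using exp_ind with
  | h0 => rw [mono_zero, map_one, ← mono_zero]; exact mono_mem_Sp (by simp [degA_zero])
  | h1 i => rw [mono_single, degA_single]; exact h i
  | hadd a b ha hb =>
    rw [mono_add, map_mul]
    exact mul_mem_Sp (by simp [degA_add]) ha hb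

theorem K_comp {k l d : ℕ} (g : P k →ₐ[ZMod 2] P l) (h : ∀ i, g (X i) ∈ Sp l {1})
    (hc : ∀ f, g (SqT k f) = SqT l (g f)) {ψ : Fn l} (hψ : ψ ∈ K l d) : ψ ∘ₗ g.toLinearMap ∈ K k d := by
  refine ⟨fun a ha => ?_, fun f => ?_⟩
  · exact hψ.1.eq_zero (s := {degA a}) (by simpa using Ne.symm ha) (alg_mono_Sp g h a)
  · simp only [LinearMap.comp_apply, AlgHom.toLinearMap_apply]
    rw [hc, hψ.2]

theorem sq_comm {k l : ℕ} (g : P k →ₐ[ZMod 2] P l) (hX : ∀ i, g (SqT k (X i)) = SqT l (g (X i))) (f) :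
    g (SqT k f) = SqT l (g f) := by
  have : g.comp (SqT k) = (SqT l).comp g := by
    apply MvPolynomial.algHom_ext; exact hX
  exact congrArg (fun q => q f) this

def RR (i0 : Fin 6) (R : Finset (Fin 6)) : Finset (Fin 5) := Finset.univ.filter fun j => i0.succAbove j ∈ R
def pv (i0 : Fin 6) (R : Finset (Fin 6)) : Fin 6 → P 5 := i0.insertNth (α := fun _ => P 5) (LL (RR i0 R)) X
def pA (i0 : Fin 6) (R : Finset (Fin 6)) : P 6 →ₐ[ZMod 2] P 5 := aeval (pv i0 R)
def iA (i0 : Fin 6) : P 5 →ₐ[ZMod 2] P 6 := aeval fun j => X (i0.succAbove j)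

theorem pA_same (i0 R) : pA i0 R (X i0) = LL (RR i0 R) := by
  rw [pA, aeval_X, pv, Fin.insertNth_apply_same]
theorem pA_succ (i0 R) (j) : pA i0 R (X (i0.succAbove j)) = X j := by
  rw [pA, aeval_X, pv, Fin.insertNth_apply_succAbove]
theorem iA_X (i0) (j) : iA i0 (X j) = X (i0.succAbove j) := by rw [iA, aeval_X]

theorem LL_split {i0 : Fin 6} {R : Finset (Fin 6)} (h : i0 ∈ R) :
    LL R = X i0 + iA i0 (LL (RR i0 R)) := by
  have : LL R = ∑ i, if i ∈ R then (X i : P 6) else 0 := by rw [LL, Finset.sum_ite_mem, Finset.univ_inter]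
  rw [this, Fin.sum_univ_succAbove _ i0, if_pos h, LL, RR, map_sum, Finset.sum_filter]
  simp [iA_X]

theorem LL_mem {k : ℕ} (R : Finset (Fin k)) : LL R ∈ Sp k {1} := sum_mem fun i _ => X_mem_Sp i

theorem pA_iA (i0 R) (f) : pA i0 R (iA i0 f) = f := by
  have : (pA i0 R).comp (iA i0) = AlgHom.id _ _ := by
    apply MvPolynomial.algHom_ext; intro j
    rw [AlgHom.comp_apply, iA_X, pA_succ]; rfl
  exact congrArg (fun q => q f) this

theorem pA_LL {i0 : Fin 6} {R : Finset (Fin 6)} (h : i0 ∈ R) : pA i0 R (LL R) = 0 := by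
  rw [LL_split h, map_add, pA_same, pA_iA, two_P]

theorem pA_Sp (i0 R) (i) : pA i0 R (X i) ∈ Sp 5 {1} := by
  rcases Fin.eq_self_or_eq_succAbove i0 i with hi | ⟨j, hi⟩ <;> rw [hi]
  · rw [pA_same]; exact LL_mem _
  · rw [pA_succ]; exact X_mem_Sp _
theorem pA_Sq (i0 R) (f) : pA i0 R (SqT 6 f) = SqT 5 (pA i0 R f) := by
  refine sq_comm _ (fun i => ?_) f
  rw [SqT_X, map_add, map_pow]
  rcases Fin.eq_self_or_eq_succAbove i0 i with hi | ⟨j, hi⟩ <;> rw [hi]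
  · rw [pA_same, SqT_LL]
  · rw [pA_succ, SqT_X]
theorem iA_Sq (i0) (f) : iA i0 (SqT 5 f) = SqT 6 (iA i0 f) := by
  refine sq_comm _ (fun i => ?_) f
  rw [SqT_X, map_add, map_pow, iA_X, SqT_X]
theorem iA_Sp (i0) (i) : iA i0 (X i) ∈ Sp 6 {1} := by rw [iA_X]; exact X_mem_Sp _

theorem ip_ideal {i0 : Fin 6} {R : Finset (Fin 6)} (h : i0 ∈ R) (f : P 6) : ∃ g, iA i0 (pA i0 R f) = f + LL R * g := by
  have h1 : (Ideal.Quotient.mkₐ (ZMod 2) (Ideal.span {LL R})).comp ((iA i0).comp (pA i0 R)) =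
      Ideal.Quotient.mkₐ (ZMod 2) (Ideal.span {LL R}) := by
    apply MvPolynomial.algHom_ext; intro i
    simp only [AlgHom.comp_apply]
    rcases Fin.eq_self_or_eq_succAbove i0 i with hi | ⟨j, hi⟩ <;> rw [hi]
    ·
      rw [pA_same]
      apply Ideal.Quotient.eq.2
      rw [CharTwo.sub_eq_add, add_comm, ← LL_split h]
      exact Ideal.mem_span_singleton_self _
    · rw [pA_succ, iA_X]
  have h2 := congrArg (fun q => q f) h1
  simp only [AlgHom.comp_apply] at h2
  have h3 := Ideal.mem_span_singleton.1 (Ideal.Quotient.eq.1 h2)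
  obtain ⟨g, hg⟩ := h3
  exact ⟨g, by rw [← hg]; ring⟩

def HRe {i0 : Fin 6} {R : Finset (Fin 6)} (h : i0 ∈ R) : HR R ≃ₗ[ZMod 2] K 5 23 where
  toFun z := ⟨z.1 ∘ₗ (iA i0).toLinearMap, K_comp _ (iA_Sp i0) (iA_Sq i0) (mem_HR.1 z.2).1⟩
  map_add' a b := rfl
  map_smul' c a := rfl
  invFun ψ := ⟨ψ.1 ∘ₗ (pA i0 R).toLinearMap, mem_HR.2 ⟨K_comp _ (pA_Sp i0 R) (pA_Sq i0 R) ψ.2, by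
    apply LinearMap.ext; intro f
    rw [cap_apply, LinearMap.comp_apply, AlgHom.toLinearMap_apply, map_mul, pA_LL h, zero_mul, map_zero]; rfl⟩⟩
  left_inv z := by
    apply Subtype.ext
    apply LinearMap.ext; intro f
    change z.1 (iA i0 (pA i0 R f)) = z.1 f
    obtain ⟨g, hg⟩ := ip_ideal h f
    rw [hg, map_add, ← cap_apply, (mem_HR.1 z.2).2, LinearMap.zero_apply, add_zero]
  right_inv ψ := by
    apply Subtype.ext
    apply LinearMap.ext; intro f
    change ψ.1 (pA i0 R (iA i0 f)) = ψ.1 f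
    rw [pA_iA]

theorem finrank_6 {n : ℕ} (hn : 5 ≤ n) (h : Module.finrank (ZMod 2) (K 5 23) = 1245) :
    Module.finrank (ZMod 2) (K 6 (NN n)) = 78435 := by
  have hf : Module.Finite (ZMod 2) (K 5 23) := Module.finite_of_finrank_pos (by omega)
  have hfr : Module.Free (ZMod 2) (K 5 23) := Module.Free.of_divisionRing _ _
  rw [finrank_big hn, (LinearEquiv.piCongrRight fun R : NF => HRe R.2.choose_spec).finrank_eq, Module.finrank_pi_fintype]
  simp only [h, Finset.sum_const, Finset.card_univ]
  have : Fintype.card NF = 63 := by decide +kernel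
  rw [this]; rfl
end

section
theorem IsHit_iff {k d : ℕ} {u : P k} : IsHit k d u ↔ u ∈ hitSub k d := by
  refine ⟨fun h => Submodule.subset_span h, fun h => ?_⟩
  induction h using Submodule.span_induction with
  | mem u hu => exact hu
  | zero => exact ⟨fun _ => 0, fun _ => zero_mem _, by simp⟩
  | add u v _ _ hu hv =>
    obtain ⟨f, hf, rfl⟩ := hu
    obtain ⟨g, hg, rfl⟩ := hv
    exact ⟨fun i => f i + g i, fun i => add_mem (hf i) (hg i), by simp [Finset.sum_add_distrib]⟩
  | smul c u _ hu =>
    obtain ⟨f, hf, rfl⟩ := hu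
    refine ⟨fun i => c • f i, fun i => Submodule.smul_mem _ _ (hf i), ?_⟩
    rw [Finset.smul_sum]
    exact Finset.sum_congr rfl fun i _ => by rw [map_smul, map_smul]

theorem adm_abs {ι V : Type*} [LinearOrder ι] [Finite ι] [AddCommGroup V] [Module (ZMod 2) V] (v : ι → V)
    (hs : ⊤ ≤ Submodule.span (ZMod 2) (Set.range v)) :
    {a | v a ∉ Submodule.span (ZMod 2) (v '' Set.Iio a)}.ncard = Module.finrank (ZMod 2) V := by
  set B := {a | v a ∉ Submodule.span (ZMod 2) (v '' Set.Iio a)} with hB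
  have hli : LinearIndependent (ZMod 2) (fun a : B => v a) := by
    rw [linearIndependent_iff']
    intro s g hg
    by_contra hne
    push Not at hne
    obtain ⟨i0, hi0, hgi0⟩ := hne
    set s' := s.filter (fun i => g i ≠ 0) with hs'
    have hne' : s'.Nonempty := ⟨i0, by simp [hs', hi0, hgi0]⟩
    set m := s'.max' hne' with hm
    have hms : m ∈ s' := s'.max'_mem hne'
    have hmm := Finset.mem_filter.1 hms
    apply m.2
    have h1 : ∑ i ∈ s', g i • v i = 0 := by
      rw [← hg, hs', Finset.sum_filter_of_ne]
      intro x _ hx h0; exact hx (by rw [h0, zero_smul])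
    rw [← Finset.add_sum_erase _ _ hms] at h1
    have h2 : g m • v m ∈ Submodule.span (ZMod 2) (v '' Set.Iio (m : ι)) := by
      rw [eq_neg_of_add_eq_zero_left h1]
      refine Submodule.neg_mem _ (sum_mem fun i hi => Submodule.smul_mem _ _ (Submodule.subset_span ⟨i, ?_, rfl⟩))
      rw [Finset.mem_erase] at hi
      exact lt_of_le_of_ne (s'.le_max' i hi.2) (fun e => hi.1 (Subtype.ext e))
    exact (Submodule.smul_mem_iff _ hmm.2).1 h2
  have hsp : ⊤ ≤ Submodule.span (ZMod 2) (Set.range (fun a : B => v a)) := by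
    refine hs.trans (Submodule.span_le.2 ?_)
    rintro _ ⟨a, rfl⟩
    induction a using WellFoundedLT.induction with
    | ind a ih =>
      by_cases ha : a ∈ B
      · exact Submodule.subset_span ⟨⟨a, ha⟩, rfl⟩
      · have h1 : v a ∈ Submodule.span (ZMod 2) (v '' Set.Iio a) := by simpa [hB] using ha
        refine (Submodule.span_le.2 ?_ : Submodule.span (ZMod 2) (v '' Set.Iio a) ≤ _) h1
        rintro _ ⟨b, hb, rfl⟩
        exact ih b hb
  rw [Module.finrank_eq_nat_card_basis (Module.Basis.mk hli hsp)]
  rfl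

@[ext]
structure EX (k d : ℕ) where
  val : Fin k →₀ ℕ
  prop : degA val = d
theorem EX_inj (k d : ℕ) : Function.Injective (EX.val (k := k) (d := d)) := fun _ _ h => EX.ext h
instance (k d : ℕ) : Finite (EX k d) := by
  have h : {a : Fin k →₀ ℕ | degA a = d}.Finite := by
    apply Set.Finite.subset (Set.finite_Iic (Finsupp.equivFunOnFinite.symm fun _ => d : Fin k →₀ ℕ))
    intro a ha i
    simp only [Finsupp.equivFunOnFinite_symm_apply_apply]
    rw [← (show degA a = d from ha), degA]
    exact Finset.single_le_sum (f := fun i => a i) (fun _ _ => Nat.zero_le _) (Finset.mem_univ i)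
  have := h.to_subtype
  exact Finite.of_injective (fun a : EX k d => (⟨a.1, a.2⟩ : {a : Fin k →₀ ℕ | degA a = d}))
    fun a b hab => EX.ext (congrArg Subtype.val hab)

def key {k d : ℕ} (a : EX k d) : Lex (Lex (ℕ → ℕ) × Lex (Fin k → ℕ)) := toLex (toLex (wVec a.1), toLex (⇑a.1))
theorem key_inj {k d : ℕ} : Function.Injective (key (k := k) (d := d)) := by
  intro a b h
  have h2 : (⇑a.1 : Fin k → ℕ) = ⇑b.1 := congrArg (fun x => ofLex (ofLex x).2) h
  exact EX.ext (DFunLike.coe_injective h2)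
instance (k d : ℕ) : LinearOrder (EX k d) := LinearOrder.lift' key key_inj
theorem lt_iff {k d : ℕ} (a b : EX k d) : a < b ↔ monLt a.1 b.1 := by
  change key a < key b ↔ _
  rw [Prod.Lex.lt_iff]
  rfl

def vq {k d : ℕ} (a : EX k d) : QP k d := Submodule.mkQ _ (hcL k d (mono a.1))

theorem hcL_hom {k d : ℕ} (x : homSub k d) : hcL k d x.1 = x := by
  apply Subtype.ext
  change homogeneousComponent d x.1 = x.1
  have := homogeneousComponent_of_mem (m := d) (n := d) (p := x.1) ((mem_homogeneousSubmodule _ _).1 x.2)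
  rw [this, if_pos rfl]

theorem vq_span (k d : ℕ) : ⊤ ≤ Submodule.span (ZMod 2) (Set.range (vq (k := k) (d := d))) := by
  intro q _
  obtain ⟨x, rfl⟩ := Submodule.mkQ_surjective _ q
  rw [← hcL_hom x]
  have h := hom_le_Sp x.2
  have : Sp k {d} ≤ (Submodule.span (ZMod 2) (Set.range (vq (k := k) (d := d)))).comap
      (Submodule.mkQ ((hitSub k d).comap (homSub k d).subtype) ∘ₗ hcL k d) := by
    refine Submodule.span_le.2 ?_
    rintro _ ⟨a, ha, rfl⟩
    exact Submodule.subset_span ⟨⟨a, ha⟩, rfl⟩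
  exact this h

theorem vq_eq {k d : ℕ} (a : EX k d) (S : Finset (EX k d)) :
    vq a = ∑ b ∈ S, vq b ↔ mono a.1 - ∑ b ∈ S, mono b.1 ∈ hitSub k d := by
  have h0 : ∀ a : EX k d, (hcL k d (mono a.1)).1 = mono a.1 := by
    intro a
    change homogeneousComponent d (mono a.1) = _
    rw [hc_mono, if_pos a.2]
  simp only [vq]
  rw [← map_sum, ← map_sum, ← sub_eq_zero, ← map_sub, ← map_sub, Submodule.mkQ_apply, Submodule.Quotient.mk_eq_zero,
    Submodule.mem_comap, map_sub, map_sub, map_sum, map_sum]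
  simp only [Submodule.subtype_apply, h0]

theorem adm_iff {k d : ℕ} (a : EX k d) :
    Admissible a.1 ↔ vq a ∉ Submodule.span (ZMod 2) (vq '' Set.Iio a) := by
  rw [Admissible, not_iff_not]
  constructor
  · rintro ⟨S, hS, hit⟩
    have ha : ∀ b ∈ S, degA b = d := fun b hb => (hS b hb).1.trans a.2
    have h1 : vq a = ∑ b ∈ S.attach, vq (⟨b.1, ha b.1 b.2⟩ : EX k d) := by
      have := (vq_eq a (S.attach.image fun b => (⟨b.1, ha b.1 b.2⟩ : EX k d))).2 ?_
      · rwa [Finset.sum_image] at this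
        intro x _ y _ h; exact Subtype.ext (congrArg (fun z => z.1) h)
      · rw [Finset.sum_image, Finset.sum_attach S (fun b => mono b), ← IsHit_iff]
        · have := a.2
          rw [this] at hit
          exact hit
        · intro x _ y _ h; exact Subtype.ext (congrArg (fun z => z.1) h)
    rw [h1]
    refine sum_mem fun b _ => Submodule.subset_span ⟨_, ?_, rfl⟩
    exact (lt_iff _ _).2 (hS b.1 b.2).2
  · intro h
    obtain ⟨l, hl, he⟩ := (Finsupp.mem_span_image_iff_linearCombination (ZMod 2)).1 h
    have hl' : ∀ b ∈ l.support, b < a := fun b hb => hl hb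
    have h1 : vq a = ∑ b ∈ l.support, vq b := by
      rw [← he, Finsupp.linearCombination_apply, Finsupp.sum]
      refine Finset.sum_congr rfl fun b hb => ?_
      have hz : ∀ c : ZMod 2, c ≠ 0 → c = 1 := by decide
      rw [hz _ (Finsupp.mem_support_iff.1 hb), one_smul]
    refine ⟨l.support.image EX.val, ?_, ?_⟩
    · intro b hb
      obtain ⟨b, hb2, rfl⟩ := Finset.mem_image.1 hb
      exact ⟨b.2.trans a.2.symm, (lt_iff _ _).1 (hl' b hb2)⟩
    · rw [Finset.sum_image (by intro x _ y _ h; exact EX.ext h), a.2, IsHit_iff]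
      exact (vq_eq a _).1 h1

theorem adm_count (k d : ℕ) : {a : Fin k →₀ ℕ | degA a = d ∧ Admissible a}.ncard = Module.finrank (ZMod 2) (QP k d) := by
  rw [← adm_abs _ (vq_span k d)]
  rw [← Set.ncard_image_of_injective _ (EX_inj k d)]
  congr 1
  ext a
  constructor
  · rintro ⟨h1, h2⟩
    exact ⟨⟨a, h1⟩, (adm_iff ⟨a, h1⟩).1 h2, rfl⟩
  · rintro ⟨b, h1, rfl⟩
    exact ⟨b.2, (adm_iff b).2 h1⟩

theorem NN_form (n : ℕ) : NN n = 5 * (2 ^ n - 1) + 23 * 2 ^ n := by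
  have := NN_eq n
  have h2 : 0 < 2 ^ n := by positivity
  omega

theorem final_of (h : Module.finrank (ZMod 2) (K 5 23) = 1245) (r : ℕ) (hr : 1 ≤ r) :
    Module.finrank (ZMod 2) (QP 6 (5 * (2 ^ (r + 4) - 1) + 23 * 2 ^ (r + 4))) = 78435 ∧
    {a : Fin 6 →₀ ℕ | degA a = 5 * (2 ^ (r + 4) - 1) + 23 * 2 ^ (r + 4) ∧ Admissible a}.ncard = 78435 := by
  rw [adm_count, finrank_QP, ← NN_form, finrank_6 (by omega) h]
  exact ⟨rfl, rfl⟩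
end

section
namespace CC
inductive Tr | lf (v : Nat) | nd (b : Nat) (l r : Tr)
@[reducible] def FN {α : Type} (v : Nat) (k : Nat → α) : α := Nat.rec (motive := fun _ => α) (k (nat_lit 0)) (fun n _ => k (Nat.succ n)) v
@[reducible] def FT {α : Type} (t : Tr) (k : Tr → α) : α :=
  Tr.rec (motive := fun _ => α) (fun v => k (.lf v)) (fun b l r _ _ => k (.nd b l r)) t
@[reducible] def ite' {α : Type} (b : Bool) (x y : α) : α := Bool.rec (motive := fun _ => α) y x b
def build {α : Type} (n : Nat) : Nat → (Tr → α) → α :=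
  Nat.rec (motive := fun _ => Nat → (Tr → α) → α) (fun _ c => c (.lf (nat_lit 0)))
    (fun n ih o c => ih o fun l => FN (Nat.add o (Nat.pow (nat_lit 2) n)) fun m => ih m fun r => 
       FN (Nat.sub (Nat.pow (nat_lit 2) (Nat.add m (nat_lit 32))) (Nat.mul m (nat_lit 261773))) fun b => c (.nd b l r)) n
def go {α : Type} (x : Nat) (again : Nat → α) (t : Tr) : (Tr → α) → α :=
  Tr.rec (motive := fun _ => (Tr → α) → α)
    (fun v put => ite' (Nat.beq v (nat_lit 0)) (put (.lf x)) (again v))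
    (fun b l r ihl ihr put => ite' (Nat.ble b x) (ihr fun r' => put (.nd b l r')) (ihl fun l' => put (.nd b l' r))) t
def ins (t : Tr) (fuel : Nat) : Nat → Tr :=
  Nat.rec (motive := fun _ => Nat → Tr) (fun x => .nd (nat_lit 0) (.lf x) t)
    (fun _ ih x => FN x fun x => ite' (Nat.beq x (nat_lit 0)) t (go x (fun v => ih (Nat.xor x v)) t (fun t' => t'))) fuel
def flat (t : Tr) : List Nat → List Nat := Tr.rec (motive := fun _ => List Nat → List Nat)
  (fun v acc => ite' (Nat.beq v (nat_lit 0)) acc (v :: acc)) (fun _ _ _ ihl ihr acc => ihl (ihr acc)) t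
/-- consecutive leading bits increase, and the list has exactly `N` entries -/
def chk (B N : Nat) (l : List Nat) : Nat → Nat → Bool := List.rec (motive := fun _ => Nat → Nat → Bool)
  (fun p n => ite' (Nat.beq n N) (Nat.ble (Nat.succ p) B) false)
  (fun q _ ih p n => ite' (Nat.ble (Nat.succ p) q) (ite' (Nat.ble (Nat.succ p) (Nat.xor p q)) (FN (Nat.succ n) fun n => ih q n) false) false) l
def comps (n : Nat) : Nat → List (List Nat) := Nat.rec (motive := fun _ => Nat → List (List Nat))
  (fun d => ite' (Nat.beq d (nat_lit 0)) [[]] [])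
  (fun _ ih d => (List.range (Nat.succ d)).flatMap fun a => FN a fun a => FN (Nat.sub d a) fun e => (ih e).map fun t => a :: t) n
def xorR (n : Nat) (h : Nat → Nat) : Nat := Nat.rec (motive := fun _ => Nat) (nat_lit 0) (fun j ih => Nat.xor (h j) ih) n
def sqR (l : List Nat) : Nat → (List Nat → Nat) → Nat := List.rec (motive := fun _ => Nat → (List Nat → Nat) → Nat)
  (fun i g => ite' (Nat.beq i (nat_lit 0)) (g []) (nat_lit 0))
  (fun a _ ih i g => xorR (Nat.succ i) fun j => ite' (Nat.beq (Nat.land a j) j)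
      (FN (Nat.add a j) fun b => FN (Nat.sub i j) fun i' => ih i' fun t => g (b :: t)) (nat_lit 0)) l
def hd (l : List Nat) : Nat := List.rec (motive := fun _ => Nat) (nat_lit 0) (fun a _ _ => a) l
def tl (l : List Nat) : List Nat := List.rec (motive := fun _ => List Nat) [] (fun _ t _ => t) l
def rk (l : List Nat) : Nat :=
  FN (hd (tl (tl (tl (tl l))))) fun s4 => FN (Nat.add (hd (tl (tl (tl l)))) s4) fun s3 => 
  FN (Nat.add (hd (tl (tl l))) s3) fun s2 => FN (Nat.add (hd (tl l)) s2) fun s1 =>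
  Nat.add (Nat.add s4 (Nat.div (Nat.mul s3 (Nat.succ s3)) (nat_lit 2)))
    (Nat.add (Nat.div (Nat.mul (Nat.mul s2 (Nat.succ s2)) (Nat.add s2 (nat_lit 2))) (nat_lit 6))
       (Nat.div (Nat.mul (Nat.mul s1 (Nat.succ s1)) (Nat.mul (Nat.add s1 (nat_lit 2)) (Nat.add s1 (nat_lit 3)))) (nat_lit 24)))
/-- column bit -/
def bitC (B : Nat) (t : List Nat) : Nat := FN (Nat.sub B (rk t)) fun k =>
  Nat.xor (Nat.pow (nat_lit 2) (Nat.add k (nat_lit 32))) (Nat.mul k (nat_lit 390001))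
def incr (l : List Nat) : Nat → List Nat := List.rec (motive := fun _ => Nat → List Nat) (fun _ => [])
  (fun a l ih i => Nat.rec (motive := fun _ => List Nat) (Nat.succ a :: l) (fun j _ => a :: ih j) i) l
def elimC (row : List Nat → Nat) (fs : List (List Nat)) : Tr → Tr :=
  List.rec (motive := fun _ => Tr → Tr) (fun t => t) (fun f _ ih t => FT (ins t (nat_lit 100000) (row f)) fun t' => ih t') fs
def elimD (row : Nat → List Nat → Nat) (d : Nat) : Tr → Tr :=
  Nat.rec (motive := fun _ => Tr → Tr) (fun t => t) (fun d ih t => FT (elimC (row d) (comps (nat_lit 5) d) t) fun t' => ih t') d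
def thr (es : List Nat) (s : Nat → Tr → Tr) : Tr → Tr := 
  List.rec (motive := fun _ => Tr → Tr) (fun t => t) (fun e _ ih t => FT (s e t) fun t' => ih t') es
-- block bases
def R0 : Tr → Tr := thr [1000, 2001, 3002, 4003, 5004, 6005, 7006, 8007, 9008, 10009] fun B => elimD (fun d f => sqR f (Nat.sub (nat_lit 10) d) (bitC B)) (nat_lit 10)
def xl4 (f : List Nat) (i1 B1 i2 B2 i3 B3 i4 B4 : Nat) : Nat :=
  Nat.xor (Nat.xor (bitC B1 (incr f i1)) (bitC B2 (incr f i2))) (Nat.xor (bitC B3 (incr f i3)) (bitC B4 (incr f i4)))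
-- 012→0,013→1,014→2,023→3,024→4,034→5,123→6,124→7,134→8,234→9
def R1a (i1 B1 i2 B2 i3 B3 i4 B4 : Nat) : Tr → Tr := elimC (fun f => xl4 f i1 B1 i2 B2 i3 B3 i4 B4) (comps (nat_lit 5) (nat_lit 9))
def R1 (t : Tr) : Tr := 
   FT (R1a 0 7006 1 4003 2 2001 3 1000 t) fun t => -- 0123: 123,023,013,012
   FT (R1a 0 8007 1 5004 2 3002 4 1000 t) fun t => -- 0124: 124,024,014,012
   FT (R1a 0 9008 1 6005 3 3002 4 2001 t) fun t => -- 0134: 134 034 014 013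
   FT (R1a 0 10009 2 6005 3 5004 4 4003 t) fun t => -- 0234: 234 034 024 023
   (R1a 1 10009 2 9008 3 8007 4 7006 t) -- 1234: 234 134 124 123
def x2 (t : List Nat) (i j B : Nat) : Nat := bitC B (incr (incr t i) j)
def row2 (d : Nat) (f : List Nat) : Nat := Nat.xor (sqR f (Nat.sub (nat_lit 9) d) (bitC (nat_lit 10724)))
  (sqR f (Nat.sub (nat_lit 8) d) fun t => 
   Nat.xor (Nat.xor (Nat.xor (x2 t 0 1 10009) (x2 t 0 2 9008)) (Nat.xor (x2 t 0 3 8007) (x2 t 0 4 7006)))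
    (Nat.xor (Nat.xor (Nat.xor (x2 t 1 2 6005) (x2 t 1 3 5004)) (Nat.xor (x2 t 1 4 4003) (x2 t 2 3 3002))) (Nat.xor (x2 t 2 4 2001) (x2 t 3 4 1000))))
def R2 : Tr → Tr := elimD row2 (nat_lit 9)
def fin : Tr := build (nat_lit 14) (nat_lit 0) (fun t => FT (R0 t) fun t => FT (R1 t) fun t => R2 t)

end CC
end

section
namespace CC
set_option maxHeartbeats 0 in
theorem compute : chk (Nat.pow (nat_lit 2) (nat_lit 10757)) (nat_lit 9480) (flat fin []) (nat_lit 4294967295) (nat_lit 0) = true := by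
  decide +kernel
theorem ck10 : (comps 5 10).map rk = (List.range 1001).reverse := by decide +kernel
theorem ck9 : (comps 5 9).map rk = (List.range 715).reverse := by decide +kernel
end CC
end

section
namespace CC
theorem FN_eq {α : Type} (v : Nat) (k : Nat → α) : FN v k = k v := by cases v <;> rfl
theorem FT_eq {α : Type} (t : Tr) (k : Tr → α) : FT t k = k t := by cases t <;> rfl
theorem ite'_eq {α : Type} (b : Bool) (x y : α) : ite' b x y = if b = true then x else y := by cases b <;> rfl

def ev (c : ℕ → ZMod 2) (r : ℕ) : ZMod 2 := ∑ i ∈ Finset.range 10725, if r.testBit (i + 32) then c i else 0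

theorem ev_zero (c) : ev c 0 = 0 := by simp [ev]
theorem ev_xor (c) (r s : ℕ) : ev c (Nat.xor r s) = ev c r + ev c s := by
  have : Nat.xor r s = r ^^^ s := rfl
  rw [this, ev, ev, ev, ← Finset.sum_add_distrib]
  refine Finset.sum_congr rfl fun i _ => ?_
  rw [Nat.testBit_xor]
  cases r.testBit (i + 32) <;> cases s.testBit (i + 32) <;> simp [CharTwo.add_self_eq_zero]
theorem ev_bitC (c) (B : ℕ) (hB : B ≤ 10724) (t) : ev c (bitC B t) = c (B - rk t) := by
  have e : bitC B t = Nat.xor (2 ^ (B - rk t + 32)) ((B - rk t) * 390001) := by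
    rw [bitC, FN_eq]; rfl
  have hk : B - rk t ≤ 10724 := by omega
  generalize B - rk t = k at *
  rw [e, ev_xor]
  have h2 : ev c (k * 390001) = 0 := by
    refine Finset.sum_eq_zero fun i _ => ?_
    rw [Nat.testBit_lt_two_pow]; · simp
    calc k * 390001 < 2 ^ 32 := by omega
      _ ≤ 2 ^ (i + 32) := Nat.pow_le_pow_right (by norm_num) (by omega)
  rw [h2, add_zero, ev, Finset.sum_eq_single k]
  · simp
  · intro i _ hi
    rw [Nat.testBit_two_pow_of_ne (by omega)]; simp
  · intro h; simp at h; omega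

def good (c : ℕ → ZMod 2) : Tr → Prop
  | .lf v => ev c v = 0
  | .nd _ l r => good c l ∧ good c r

theorem go_spec (c) {G : Tr → Prop} (x : ℕ) (again : ℕ → Tr) (T0 : Prop)
    (ha : ∀ v, G (again v) ↔ T0 ∧ ev c x + ev c v = 0) (t : Tr) :
    ∀ (C : Prop) (put : Tr → Tr), (∀ s, G (put s) ↔ C ∧ good c s) → (T0 ↔ C ∧ good c t) →
      (G (go x again t put) ↔ T0 ∧ ev c x = 0) := by
  induction t with
  | lf v =>
    intro C put hp h0
    change G (ite' (Nat.beq v 0) (put (.lf x)) (again v)) ↔ _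
    rw [ite'_eq]
    split
    · next h =>
      have hv : v = 0 := Nat.eq_of_beq_eq_true h
      rw [hp, h0]; simp [good, hv, ev_zero]
    · rw [ha, h0]
      constructor
      · rintro ⟨⟨h1, h2⟩, h3⟩
        have h4 : ev c v = 0 := h2
        rw [h4, add_zero] at h3
        exact ⟨⟨h1, h2⟩, h3⟩
      · rintro ⟨⟨h1, h2⟩, h3⟩
        have h4 : ev c v = 0 := h2
        exact ⟨⟨h1, h2⟩, by rw [h3, h4, add_zero]⟩
  | nd b l r ihl ihr =>
    intro C put hp h0
    change G (ite' (Nat.ble b x) (go x again r fun r' => put (.nd b l r')) (go x again l fun l' => put (.nd b l' r))) ↔ _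
    rw [ite'_eq]
    split
    · refine ihr (C ∧ good c l) _ (fun s => ?_) ?_
      · rw [hp]; simp [good, and_assoc]
      · rw [h0]; simp [good, and_assoc]
    · refine ihl (C ∧ good c r) _ (fun s => ?_) ?_
      · rw [hp]; simp [good]; tauto
      · rw [h0]; simp [good]; tauto

theorem ins_spec (c) (t : Tr) (fuel : ℕ) : ∀ x, good c (ins t fuel x) ↔ good c t ∧ ev c x = 0 := by
  induction fuel with
  | zero => intro x; exact ⟨fun h => ⟨h.2, h.1⟩, fun h => ⟨h.2, h.1⟩⟩
  | succ n ih =>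
    intro x
    change good c (FN x fun x => ite' (Nat.beq x 0) t (go x (fun v => ins t n (Nat.xor x v)) t (fun t' => t'))) ↔ _
    rw [FN_eq, ite'_eq]
    split
    · next h =>
      have hv : x = 0 := Nat.eq_of_beq_eq_true h
      simp [hv, ev_zero]
    · refine go_spec c x _ (good c t) (fun v => ?_) t True _ (fun s => by simp) (by simp)
      rw [ih, ev_xor]

theorem build_spec (c) (n : ℕ) : ∀ o, ∃ t, good c t ∧ ∀ k : Tr → Tr, build n o k = k t := by
  induction n with
  | zero => intro o; exact ⟨.lf 0, ev_zero c, fun k => rfl⟩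
  | succ n ih =>
    intro o
    obtain ⟨l, hl, el⟩ := ih o
    obtain ⟨r, hr, er⟩ := ih (Nat.add o (Nat.pow 2 n))
    refine ⟨.nd (Nat.sub (Nat.pow 2 (Nat.add (Nat.add o (Nat.pow 2 n)) 32)) (Nat.mul (Nat.add o (Nat.pow 2 n)) 261773)) l r, ⟨hl, hr⟩, fun k => ?_⟩
    change build n o (fun l => FN (Nat.add o (Nat.pow 2 n)) fun m => build n m fun r =>
       FN (Nat.sub (Nat.pow 2 (Nat.add m 32)) (Nat.mul m 261773)) fun b => k (.nd b l r)) = _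
    rw [el, FN_eq, er, FN_eq]

theorem elimC_spec (c) (row : List ℕ → ℕ) (fs : List (List ℕ)) : ∀ t,
    good c (elimC row fs t) ↔ good c t ∧ ∀ f ∈ fs, ev c (row f) = 0 := by
  induction fs with
  | nil => intro t; change good c t ↔ _; simp
  | cons f fs ih =>
    intro t
    change good c (FT (ins t (nat_lit 100000) (row f)) fun t' => elimC row fs t') ↔ _
    rw [FT_eq, ih, ins_spec]; simp [and_assoc]

theorem elimD_spec (c) (row : ℕ → List ℕ → ℕ) (d : ℕ) : ∀ t,
    good c (elimD row d t) ↔ good c t ∧ ∀ e < d, ∀ f ∈ comps 5 e, ev c (row e f) = 0 := by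
  induction d with
  | zero => intro t; change good c t ↔ _; simp
  | succ d ih =>
    intro t
    change good c (FT (elimC (row d) (comps 5 d) t) fun t' => elimD row d t') ↔ _
    rw [FT_eq, ih, elimC_spec]
    simp only [Nat.lt_succ_iff_lt_or_eq, or_imp, forall_and, forall_eq]
    tauto

theorem thr_spec (c) (s : ℕ → Tr → Tr) (Q : ℕ → Prop) (hs : ∀ e t, good c (s e t) ↔ good c t ∧ Q e) (es : List ℕ) : ∀ t,
    good c (thr es s t) ↔ good c t ∧ ∀ e ∈ es, Q e := by
  induction es with
  | nil => intro t; change good c t ↔ _; simp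
  | cons e es ih =>
    intro t
    change good c (FT (s e t) fun t' => thr es s t') ↔ _
    rw [FT_eq, ih, hs]; simp [and_assoc]

theorem flat_spec (c) (t : Tr) : ∀ acc, (∀ v ∈ flat t acc, ev c v = 0) ↔ good c t ∧ ∀ v ∈ acc, ev c v = 0 := by
  induction t with
  | lf v =>
    intro acc
    change (∀ w ∈ ite' (Nat.beq v 0) acc (v :: acc), ev c w = 0) ↔ _
    rw [ite'_eq]
    split
    · next h =>
      have hv : v = 0 := Nat.eq_of_beq_eq_true h
      simp [good, hv, ev_zero]
    · simp [good]
  | nd b l r ihl ihr =>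
    intro acc
    change (∀ w ∈ flat l (flat r acc), ev c w = 0) ↔ _
    rw [ihl, ihr]; simp [good, and_assoc]

attribute [local irreducible] ins elimC elimD thr build comps sqR flat
def bases : List ℕ := [1000, 2001, 3002, 4003, 5004, 6005, 7006, 8007, 9008, 10009]
def q1 (c : ℕ → ZMod 2) (i1 B1 i2 B2 i3 B3 i4 B4 : ℕ) : Prop := ∀ f ∈ comps 5 9, ev c (xl4 f i1 B1 i2 B2 i3 B3 i4 B4) = 0

theorem r1gen (a b c d e : Tr → Tr) (t : Tr) :
    FT (a t) (fun t => FT (b t) fun t => FT (c t) fun t => FT (d t) fun t => e t) = e (d (c (b (a t)))) := by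
  simp only [FT_eq]
theorem fin_spec (c) : (∀ v ∈ flat fin [], ev c v = 0) ↔
    (∀ B ∈ bases, ∀ d < 10, ∀ f ∈ comps 5 d, ev c (sqR f (10 - d) (bitC B)) = 0) ∧
    (q1 c 0 7006 1 4003 2 2001 3 1000 ∧ q1 c 0 8007 1 5004 2 3002 4 1000 ∧ q1 c 0 9008 1 6005 3 3002 4 2001 ∧
     q1 c 0 10009 2 6005 3 5004 4 4003 ∧ q1 c 1 10009 2 9008 3 8007 4 7006) ∧
    (∀ d < 9, ∀ f ∈ comps 5 d, ev c (row2 d f) = 0) := by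
  have h1 : ∀ t, good c (R1 t) ↔ good c t ∧ (q1 c 0 7006 1 4003 2 2001 3 1000 ∧ q1 c 0 8007 1 5004 2 3002 4 1000 ∧
      q1 c 0 9008 1 6005 3 3002 4 2001 ∧
      q1 c 0 10009 2 6005 3 5004 4 4003 ∧ q1 c 1 10009 2 9008 3 8007 4 7006) := by
    intro t
    have e : R1 t = R1a 1 10009 2 9008 3 8007 4 7006 (R1a 0 10009 2 6005 3 5004 4 4003 (R1a 0 9008 1 6005 3 3002 4 2001
       (R1a 0 8007 1 5004 2 3002 4 1000 (R1a 0 7006 1 4003 2 2001 3 1000 t)))) := 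
      r1gen (R1a 0 7006 1 4003 2 2001 3 1000) (R1a 0 8007 1 5004 2 3002 4 1000) (R1a 0 9008 1 6005 3 3002 4 2001)
        (R1a 0 10009 2 6005 3 5004 4 4003) (R1a 1 10009 2 9008 3 8007 4 7006) t
    have hh : ∀ i1 B1 i2 B2 i3 B3 i4 B4 t, good c (R1a i1 B1 i2 B2 i3 B3 i4 B4 t) ↔ good c t ∧ q1 c i1 B1 i2 B2 i3 B3 i4 B4 :=
      fun i1 B1 i2 B2 i3 B3 i4 B4 t => elimC_spec c _ _ t
    refine (iff_of_eq (congrArg (good c) e)).trans ?_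
    simp only [hh, and_assoc]
  have h0 : ∀ t, good c (R0 t) ↔ good c t ∧ ∀ B ∈ bases, ∀ d < 10, ∀ f ∈ comps 5 d, ev c (sqR f (10 - d) (bitC B)) = 0 :=
    thr_spec c _ _ (fun B t => elimD_spec c _ _ t) _
  have h2 : ∀ t, good c (R2 t) ↔ good c t ∧ ∀ d < 9, ∀ f ∈ comps 5 d, ev c (row2 d f) = 0 := elimD_spec c _ _
  obtain ⟨t, ht, e⟩ := build_spec c (nat_lit 14) (nat_lit 0)
  have e2 : fin = R2 (R1 (R0 t)) := (e _).trans ((FT_eq _ _).trans (FT_eq _ _))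
  refine (flat_spec c _ _).trans ?_
  have e3 : good c fin ↔ good c (R2 (R1 (R0 t))) := e2 ▸ Iff.rfl
  have e4 := (h2 (R1 (R0 t))).trans (and_congr_left' ((h1 (R0 t)).trans (and_congr_left' (h0 t))))
  constructor
  · intro h
    have := e4.1 (e3.1 h.1)
    exact ⟨this.1.1.2, this.1.2, this.2⟩
  · intro h
    exact ⟨e3.2 (e4.2 ⟨⟨⟨ht, h.1⟩, h.2.1⟩, h.2.2⟩), by simp⟩
end CC
end

section
namespace CC
theorem lead_lt {p q : ℕ} (hp : p ≠ 0) (h1 : p < q) (h2 : p < p ^^^ q) : p.log2 < q.log2 := by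
  have hq : q ≠ 0 := by omega
  rcases Nat.lt_or_ge p.log2 q.log2 with h | h
  · exact h
  exfalso
  have hpl := Nat.log2_self_le hp
  have hql : q < 2 ^ (p.log2 + 1) := lt_of_lt_of_le Nat.lt_log2_self (Nat.pow_le_pow_right (by norm_num) (by omega))
  have hpu : p < 2 ^ (p.log2 + 1) := Nat.lt_log2_self
  have hx : p ^^^ q < 2 ^ p.log2 := by
    apply Nat.lt_pow_two_of_testBit
    intro i hi
    rw [Nat.testBit_xor]
    rcases Nat.lt_or_ge i (p.log2 + 1) with h3 | h3
    · have : i = p.log2 := by omega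
      subst this
      rw [Nat.testBit_eq_decide_div_mod_eq, Nat.testBit_eq_decide_div_mod_eq]
      have e1 : p / 2 ^ p.log2 = 1 := Nat.div_eq_of_lt_le (by omega) (by rw [pow_succ] at hpu; omega)
      have e2 : q / 2 ^ p.log2 = 1 := Nat.div_eq_of_lt_le (by omega) (by rw [pow_succ] at hql; omega)
      rw [e1, e2]; rfl
    · have h4 : 2 ^ (p.log2 + 1) ≤ 2 ^ i := Nat.pow_le_pow_right (by norm_num) h3
      rw [Nat.testBit_lt_two_pow (by omega), Nat.testBit_lt_two_pow (by omega)]; rfl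
  omega

theorem ev_congr {c c' : ℕ → ZMod 2} {q : ℕ} (h : ∀ i, i + 32 ≤ q.log2 → c i = c' i) : ev c q = ev c' q := by
  refine Finset.sum_congr rfl fun i _ => ?_
  split
  · next hb => 
    apply h
    by_contra hh
    rw [Nat.testBit_lt_two_pow] at hb
    · simp at hb
    · exact lt_of_lt_of_le Nat.lt_log2_self (Nat.pow_le_pow_right (by norm_num) (by omega))
  · rfl

theorem chk_spec (N : ℕ) (L : List ℕ) : ∀ p n, 2 ^ 32 - 1 ≤ p → chk (2 ^ 10757) N L p n = true →
    p < 2 ^ 10757 ∧ n + L.length = N ∧ ∀ (c0 b : ℕ → ZMod 2), ∃ c : ℕ → ZMod 2, (∀ i, i + 32 ≤ p.log2 → c i = c0 i) ∧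
      ∀ j (hj : j < L.length), ev c L[j] = b j := by
  induction L with
  | nil =>
    intro p n hp h
    change ite' (Nat.beq n N) (Nat.ble (Nat.succ p) (2 ^ 10757)) false = true at h
    rw [ite'_eq] at h
    split at h
    · next h1 =>
      refine ⟨Nat.le_of_ble_eq_true h, Nat.eq_of_beq_eq_true h1, fun c0 b => ⟨c0, fun _ _ => rfl, ?_⟩⟩
      intro j hj; simp at hj
    · simp at h
  | cons q L ih =>
    intro p n hp h
    change ite' (Nat.ble (Nat.succ p) q) (ite' (Nat.ble (Nat.succ p) (Nat.xor p q))
      (FN (Nat.succ n) fun n => chk (2 ^ 10757) N L q n) false) false = true at h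
    rw [ite'_eq, ite'_eq, FN_eq] at h
    split at h
    swap
    · simp at h
    next h1 =>
    split at h
    swap
    · simp at h
    next h2 =>
    have h1 : p < q := Nat.le_of_ble_eq_true h1
    have h2 : p < p ^^^ q := Nat.le_of_ble_eq_true h2
    have hlt := lead_lt (by omega) h1 h2
    have hp31 : 31 ≤ p.log2 := (Nat.le_log2 (by omega)).2 (by omega)
    obtain ⟨i1, i2, i3⟩ := ih q (n + 1) (by omega) h
    have hqM : q.log2 < 10757 := (Nat.log2_lt (by omega)).2 i1
    refine ⟨by omega, by simp; omega, fun c0 b => ?_⟩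
    set k := q.log2 - 32 with hk
    have hk2 : k + 32 = q.log2 := by omega
    let c1 := Function.update c0 k (c0 k + (b 0 + ev c0 q))
    have hc1 : ev c1 q = b 0 := by
      have : ev c1 q = ev c0 q + (b 0 + ev c0 q) := by
        rw [← sub_eq_iff_eq_add', ev]
        conv_lhs => rw [ev]
        rw [← Finset.sum_sub_distrib, Finset.sum_eq_single k]
        · have : q.testBit (k + 32) = true := by rw [hk2]; exact Nat.testBit_log2 (by omega)
          simp [this, c1]
        · intro i _ hi
          simp [c1, Function.update_of_ne hi]
        · intro h; simp at h; omega
      rw [this, add_comm (b 0), ← add_assoc, CharTwo.add_self_eq_zero, zero_add]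
    obtain ⟨c, hc, hb⟩ := i3 c1 (fun j => b (j + 1))
    refine ⟨c, fun i hi => ?_, fun j hj => ?_⟩
    · rw [hc i (by omega)]
      exact Function.update_of_ne (by omega) _ _
    · cases j with
      | zero => rw [List.getElem_cons_zero, ev_congr hc, hc1]
      | succ j => simpa using hb j (by simpa using hj)

def ext0 : (Fin 10725 → ZMod 2) →ₗ[ZMod 2] (ℕ → ZMod 2) where
  toFun c i := if h : i < 10725 then c ⟨i, h⟩ else 0
  map_add' c c' := by ext i; simp only [Pi.add_apply]; split <;> simp
  map_smul' c c' := by ext i; simp only [Pi.smul_apply]; split <;> simp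

def evL (r : ℕ) : (ℕ → ZMod 2) →ₗ[ZMod 2] ZMod 2 where
  toFun c := ev c r
  map_add' c c' := by
    simp only [ev, ← Finset.sum_add_distrib]; refine Finset.sum_congr rfl fun i _ => ?_
    split <;> simp
  map_smul' c c' := by
    simp only [ev, smul_eq_mul, Finset.mul_sum, RingHom.id_apply]; refine Finset.sum_congr rfl fun i _ => ?_
    split <;> simp

theorem evL_apply (r c) : evL r c = ev c r := by unfold evL; rw [LinearMap.coe_mk, AddHom.coe_mk]
attribute [local irreducible] ev
def WW (L : List ℕ) : Submodule (ZMod 2) (Fin 10725 → ZMod 2) where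
  carrier := {c | ∀ v ∈ L, evL v (ext0 c) = 0}
  zero_mem' v _ := by rw [map_zero, map_zero]
  add_mem' := by
    intro a b ha hb v hv
    rw [map_add, map_add, ha v hv, hb v hv, add_zero]
  smul_mem' := by
    intro a b hb v hv
    rw [map_smul, map_smul, hb v hv, smul_zero]
theorem mem_WW {L c} : c ∈ WW L ↔ ∀ v ∈ L, ev (ext0 c) v = 0 := Iff.rfl

theorem ev_ext0 (c : ℕ → ZMod 2) (r) : ev (ext0 fun i => c i) r = ev c r := by
  unfold ev
  refine Finset.sum_congr rfl fun i hi => ?_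
  simp only [Finset.mem_range] at hi
  simp [ext0, hi]

theorem finrank_WW {L : List ℕ} (h : chk (2 ^ 10757) 9480 L (2 ^ 32 - 1) 0 = true) : Module.finrank (ZMod 2) (WW L) = 1245 := by
  obtain ⟨-, hl, hs⟩ := chk_spec 9480 L (2 ^ 32 - 1) 0 le_rfl h
  let E : (Fin 10725 → ZMod 2) →ₗ[ZMod 2] (Fin L.length → ZMod 2) := LinearMap.pi fun j => (evL L[j]).comp ext0
  have hE : Function.Surjective E := by
    intro b
    obtain ⟨c, -, hc⟩ := hs 0 (fun j => if h : j < L.length then b ⟨j, h⟩ else 0)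
    refine ⟨fun i => c i, ?_⟩
    ext j
    have := hc j j.2
    simp only [j.2, dif_pos] at this
    rw [← this]
    exact ev_ext0 c _
  have hk : WW L = LinearMap.ker E := by
    ext c
    rw [LinearMap.mem_ker, _root_.funext_iff, mem_WW]
    change _ ↔ ∀ j : Fin L.length, ev (ext0 c) L[j] = 0
    constructor
    · intro h j; exact h _ (List.getElem_mem _)
    · intro h v hv
      obtain ⟨j, hj, rfl⟩ := List.mem_iff_getElem.1 hv
      exact h ⟨j, hj⟩
  have := E.finrank_range_add_finrank_ker
  rw [LinearMap.range_eq_top.2 hE, finrank_top, Module.finrank_fin_fun, Module.finrank_fin_fun, ← hk] at this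
  omega
end CC
end

section
namespace CC
def sqS : List ℕ → ℕ → (List ℕ → ZMod 2) → ZMod 2
  | [], i, G => if i = 0 then G [] else 0
  | a :: l, i, G => ∑ j ∈ Finset.range (i + 1), if a &&& j = j then sqS l (i - j) (fun t => G ((a + j) :: t)) else 0

theorem ev_xorR (c) (n : ℕ) (h : ℕ → ℕ) : ev c (xorR n h) = ∑ j ∈ Finset.range n, ev c (h j) := by
  induction n with
  | zero => exact ev_zero c
  | succ n ih =>
    change ev c (Nat.xor (h n) (xorR n h)) = _
    rw [ev_xor, ih, Finset.sum_range_succ, add_comm]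

theorem ev_sqR (c) (l : List ℕ) : ∀ i g, ev c (sqR l i g) = sqS l i (fun t => ev c (g t)) := by
  induction l with
  | nil =>
    intro i g
    change ev c (ite' (Nat.beq i 0) (g []) 0) = _
    rw [ite'_eq, sqS]
    by_cases h : i = 0
    · subst h; rfl
    · rw [if_neg h, if_neg, ev_zero]
      intro h2; exact h (Nat.eq_of_beq_eq_true h2)
  | cons a l ih =>
    intro i g
    change ev c (xorR (Nat.succ i) fun j => ite' (Nat.beq (Nat.land a j) j)
      (FN (Nat.add a j) fun b => FN (Nat.sub i j) fun i' => sqR l i' fun t => g (b :: t)) 0) = _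
    rw [ev_xorR, sqS]
    refine Finset.sum_congr rfl fun j _ => ?_
    rw [ite'_eq, FN_eq, FN_eq]
    by_cases h : a &&& j = j
    · rw [if_pos h, if_pos, ih]; · rfl
      change Nat.beq (a &&& j) j = true; rw [h]; exact Nat.beq_refl j
    · rw [if_neg h, if_neg, ev_zero]
      intro h2; exact h (Nat.eq_of_beq_eq_true h2)

theorem sqS_congr (l : List ℕ) : ∀ {i} {G G' : List ℕ → ZMod 2}, 
    (∀ t, t.length = l.length → t.sum = l.sum + i → G t = G' t) → sqS l i G = sqS l i G' := by
  induction l with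
  | nil =>
    intro i G G' h
    rw [sqS, sqS]
    split
    · next h0 => exact h [] rfl (by simp [h0])
    · rfl
  | cons a l ih =>
    intro i G G' h
    rw [sqS, sqS]
    refine Finset.sum_congr rfl fun j hj => ?_
    simp only [Finset.mem_range] at hj
    split
    · refine ih fun t h1 h2 => h _ (by simp [h1]) ?_
      simp only [List.sum_cons]; omega
    · rfl

def ex {k : ℕ} : List ℕ → List (Fin k) → (Fin k →₀ ℕ)
  | a :: l, x :: xs => Finsupp.single x a + ex l xs
  | _, _ => 0

theorem degA_ex {k : ℕ} (l : List ℕ) : ∀ (xs : List (Fin k)), l.length = xs.length → degA (ex l xs) = l.sum := by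
  induction l with
  | nil => intro xs _; exact degA_zero
  | cons a l ih =>
    intro xs h
    cases xs with
    | nil => simp at h
    | cons x xs => rw [ex, degA_add, degA_single, ih xs (by simpa using h), List.sum_cons]

theorem choose_par : ∀ a < 12, ∀ j < 12, ((Nat.choose a j : ℕ) : ZMod 2) = if a &&& j = j then 1 else 0 := by decide

theorem mono_single_pow {k : ℕ} (x : Fin k) (a : ℕ) : (mono (Finsupp.single x a) : P k) = X x ^ a := by
  rw [mono_eq_prod, Finset.prod_eq_single x]
  · simp
  · intro y _ hy; simp [hy.symm]
  · simp

theorem SqT_cons {k : ℕ} (φ : Fn k) (u : P k) (x : Fin k) (a : ℕ) (b : Fin k →₀ ℕ) :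
    φ (u * SqT k (mono (Finsupp.single x a + b))) =
      ∑ j ∈ Finset.range (a + 1), (Nat.choose a j : ZMod 2) * φ (u * X x ^ (a + j) * SqT k (mono b)) := by
  rw [mono_add, map_mul (SqT k), mono_single_pow, map_pow, SqT_X, add_comm, add_pow, Finset.sum_mul, Finset.mul_sum, map_sum]
  refine Finset.sum_congr rfl fun j hj => ?_
  simp only [Finset.mem_range] at hj
  have : u * ((X x ^ 2) ^ j * X x ^ (a - j) * (a.choose j : P k) * SqT k (mono b)) = 
      a.choose j • (u * X x ^ (a + j) * SqT k (mono b)) := by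
    rw [nsmul_eq_mul, ← pow_mul, ← pow_add]
    have : 2 * j + (a - j) = a + j := by omega
    rw [this]; ring
  rw [this, map_nsmul, nsmul_eq_mul]

theorem SqT_mem {k : ℕ} (b : Fin k →₀ ℕ) : SqT k (mono b) ∈ Sp k (Set.Ici (degA b)) := by
  have h1 := Sp_mono (Set.Ioi_subset_Ici_self) (SqT_mono_sub b)
  have h2 : (mono b : P k) ∈ Sp k (Set.Ici (degA b)) := mono_mem_Sp (Set.mem_Ici.2 le_rfl)
  simpa using add_mem h1 h2

theorem sqS_spec {k D : ℕ} {φ : Fn k} (h : Sup D φ) (hD : D ≤ 11) (l : List ℕ) : 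
    ∀ (xs : List (Fin k)) (_ : l.length = xs.length) (e : ℕ) (u : P k) (_ : u ∈ Sp k {e}) (_ : e + l.sum ≤ D),
    φ (u * SqT k (mono (ex l xs))) = sqS l (D - e - l.sum) (fun t => φ (u * mono (ex t xs))) := by
  induction l with
  | nil =>
    intro xs hx e u hu he
    have hz : D - e - ([] : List ℕ).sum = D - e := rfl
    rw [hz, sqS]
    simp only [ex, mono_zero, map_one]
    by_cases h0 : D - e = 0
    · rw [if_pos h0]
    · rw [if_neg h0, mul_one]
      exact h.eq_zero (s := {e}) (by simp at he ⊢; omega) hu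
  | cons a l ih =>
    intro xs hx e u hu he
    cases xs with
    | nil => simp at hx
    | cons x xs =>
    simp only [List.sum_cons] at he ⊢
    have hx' : l.length = xs.length := by simpa using hx
    rw [ex, SqT_cons, sqS]
    have hu2 : ∀ j, u * X x ^ (a + j) ∈ Sp k {e + (a + j)} := fun j =>
      mul_mem_Sp (by rintro _ rfl _ rfl; rfl) hu (X_pow_mem x (a + j))
    set i := D - e - (a + l.sum) with hi
    have key : ∀ j, j ≤ i → φ (u * X x ^ (a + j) * SqT k (mono (ex l xs))) = 
        sqS l (i - j) fun t => φ (u * mono (ex ((a + j) :: t) (x :: xs))) := by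
      intro j hj
      rw [ih xs hx' _ _ (hu2 j) (by omega)]
      have : D - (e + (a + j)) - l.sum = i - j := by omega
      rw [this]
      refine congrArg _ (funext fun t => ?_)
      rw [ex, mono_add, mono_single_pow, mul_assoc]
    have key0 : ∀ j, i < j → φ (u * X x ^ (a + j) * SqT k (mono (ex l xs))) = 0 := by
      intro j hj
      refine h.eq_zero (s := Set.Ioi D) (by simp) (mul_mem_Sp ?_ (hu2 j) (SqT_mem _))
      rintro _ rfl y hy
      rw [degA_ex _ _ hx'] at hy
      simp only [Set.mem_Ici, Set.mem_Ioi] at hy ⊢; omega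
    have e1 : ∑ j ∈ Finset.range (a + 1), (Nat.choose a j : ZMod 2) * φ (u * X x ^ (a + j) * SqT k (mono (ex l xs))) =
       ∑ j ∈ Finset.range (a + i + 1), (Nat.choose a j : ZMod 2) * φ (u * X x ^ (a + j) * SqT k (mono (ex l xs))) := by
      refine Finset.sum_subset (Finset.range_mono (by omega)) fun j _ hj => ?_
      simp only [Finset.mem_range, not_lt] at hj
      rw [Nat.choose_eq_zero_of_lt (by omega)]; simp
    have e2 : ∑ j ∈ Finset.range (i + 1), (Nat.choose a j : ZMod 2) * φ (u * X x ^ (a + j) * SqT k (mono (ex l xs))) =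
       ∑ j ∈ Finset.range (a + i + 1), (Nat.choose a j : ZMod 2) * φ (u * X x ^ (a + j) * SqT k (mono (ex l xs))) := by
      refine Finset.sum_subset (Finset.range_mono (by omega)) fun j _ hj => ?_
      simp only [Finset.mem_range, not_lt] at hj
      rw [key0 j (by omega), mul_zero]
    rw [e1, ← e2]
    refine Finset.sum_congr rfl fun j hj => ?_
    simp only [Finset.mem_range] at hj
    rw [choose_par a (by omega) j (by omega), key j (by omega)]
    split <;> simp

theorem mem_comps (n : ℕ) : ∀ d t, t ∈ comps n d ↔ t.length = n ∧ t.sum = d := by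
  induction n with
  | zero =>
    intro d t
    change t ∈ ite' (Nat.beq d 0) [[]] [] ↔ _
    rw [ite'_eq]
    split
    · next h =>
      have := Nat.eq_of_beq_eq_true h
      subst this
      simp only [List.mem_singleton, List.length_eq_zero_iff]
      constructor
      · rintro rfl; simp
      · exact fun h => h.1
    · next h =>
      simp only [List.not_mem_nil, false_iff, List.length_eq_zero_iff]
      rintro ⟨rfl, h2⟩
      apply h; rw [← h2]; rfl
  | succ n ih =>
    intro d t
    change t ∈ ((List.range (Nat.succ d)).flatMap fun a => FN a fun a => FN (Nat.sub d a) fun e => (comps n e).map fun t => a :: t) ↔ _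
    simp only [FN_eq, List.mem_flatMap, List.mem_range, List.mem_map, ih]
    constructor
    · rintro ⟨a, ha, t, ⟨h1, h2⟩, rfl⟩
      refine ⟨by simp [h1], ?_⟩
      simp only [List.sum_cons]
      have : t.sum = d - a := h2
      omega
    · rintro ⟨h1, h2⟩
      cases t with
      | nil => simp at h1
      | cons a t =>
        simp only [List.sum_cons] at h2
        refine ⟨a, by omega, t, ⟨by simpa using h1, ?_⟩, rfl⟩
        change t.sum = d - a
        omega
end CC
end

section
namespace CC
def xs5 : List (Fin 5) := [0, 1, 2, 3, 4]
def toL (a : Fin 5 →₀ ℕ) : List ℕ := [a 0, a 1, a 2, a 3, a 4]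
theorem toL_len (a) : (toL a).length = 5 := rfl
theorem ex_toL (a) : ex (toL a) xs5 = a := by
  ext i; fin_cases i <;> simp [ex, toL, xs5]
theorem toL_ex {t : List ℕ} (h : t.length = 5) : toL (ex t xs5) = t := by
  match t, h with
  | [a, b, c, d, e], _ => simp [ex, toL, xs5]
theorem toL_sum (a) : (toL a).sum = degA a := by
  conv_rhs => rw [← ex_toL a]
  rw [degA_ex _ _ rfl]
theorem toL_mem {a : Fin 5 →₀ ℕ} {d : ℕ} (h : degA a = d) : toL a ∈ comps 5 d := (mem_comps _ _ _).2 ⟨rfl, by rw [toL_sum, h]⟩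
theorem degA_ex5 {t : List ℕ} {d : ℕ} (h : t ∈ comps 5 d) : degA (ex t xs5) = d := by
  rw [mem_comps] at h
  rw [degA_ex _ _ h.1, h.2]
theorem incr_toL (a : Fin 5 →₀ ℕ) (i : Fin 5) : incr (toL a) i.val = toL (Finsupp.single i 1 + a) := by
  fin_cases i <;> simp [toL, incr, add_comm] <;> rfl

def U (B D : ℕ) (c : ℕ → ZMod 2) : Fn 5 := ofM fun a => if degA a = D then c (B - rk (toL a)) else 0
theorem U_mono (B D c a) : U B D c (mono a) = if degA a = D then c (B - rk (toL a)) else 0 := ofM_mono _ _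
theorem U_Sup (B D c) : Sup D (U B D c) := fun a h => by rw [U_mono, if_neg h]
theorem U_bit {B D : ℕ} (hB : B ≤ 10724) (c) {a : Fin 5 →₀ ℕ} (ha : degA a = D) : ev c (bitC B (toL a)) = U B D c (mono a) := by
  rw [ev_bitC c B hB, U_mono, if_pos ha]
theorem U_bit' {B D : ℕ} (hB : B ≤ 10724) (c) {t : List ℕ} (h1 : t.length = 5) (h2 : t.sum = D) :
    ev c (bitC B t) = U B D c (mono (ex t xs5)) := by
  conv_lhs => rw [← toL_ex h1]
  exact U_bit hB c (by rw [degA_ex _ _ h1, h2])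

theorem sq_U {D : ℕ} (hD : D ≤ 11) {φ : Fn 5} (h : Sup D φ) {d : ℕ} (hd : d ≤ D) {f : List ℕ} (hf : f ∈ comps 5 d) (G : List ℕ → ZMod 2)
    (hG : ∀ t, t.length = 5 → t.sum = D → G t = φ (mono (ex t xs5))) :
    sqS f (D - d) G = φ (SqT 5 (mono (ex f xs5))) := by
  rw [mem_comps] at hf
  have := sqS_spec h hD f xs5 hf.1 0 1 (by rw [← mono_zero]; exact mono_mem_Sp degA_zero) (by omega)
  rw [one_mul] at this
  rw [this, hf.2, Nat.sub_zero]
  refine sqS_congr f fun t h1 h2 => ?_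
  rw [one_mul, hG t (by omega) (by omega)]

theorem U_K {B : ℕ} (hB : B ≤ 10724) (c) : (∀ d < 10, ∀ f ∈ comps 5 d, ev c (sqR f (10 - d) (bitC B)) = 0) ↔ U B 10 c ∈ K 5 10 := by
  rw [K_iff_mono]
  have key : ∀ d < 10, ∀ f ∈ comps 5 d, ev c (sqR f (10 - d) (bitC B)) = U B 10 c (SqT 5 (mono (ex f xs5))) := by
    intro d hd f hf
    rw [ev_sqR, sq_U (by omega) (U_Sup B 10 c) (by omega) hf]
    intro t h1 h2
    exact U_bit' hB c h1 h2
  constructor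
  · intro h
    refine ⟨U_Sup _ _ _, fun a ha => ?_⟩
    have := h _ ha _ (toL_mem rfl)
    rwa [key _ ha _ (toL_mem rfl), ex_toL] at this
  · intro h d hd f hf
    rw [key d hd f hf]
    exact h.2 _ (by rw [degA_ex5 hf]; exact hd)

theorem cap_mono {i : Fin 5} {φ : Fn 5} {a} : cap (X i) φ (mono a) = φ (mono (Finsupp.single i 1 + a)) := by
  rw [cap_apply, mono_add, mono_single]

theorem cap_bit {B : ℕ} (hB : B ≤ 10724) (c) {a : Fin 5 →₀ ℕ} (ha : degA a = 9) (i : Fin 5) :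
    ev c (bitC B (incr (toL a) i.val)) = cap (X i) (U B 10 c) (mono a) := by
  rw [incr_toL, U_bit hB c (D := 10) (by rw [degA_add, degA_single, ha]), cap_mono]

theorem q1_iff (c) {B1 B2 B3 B4 : ℕ} (i1 i2 i3 i4 : Fin 5) (h1 : B1 ≤ 10724) (h2 : B2 ≤ 10724) (h3 : B3 ≤ 10724) (h4 : B4 ≤ 10724) :
    q1 c i1.val B1 i2.val B2 i3.val B3 i4.val B4 ↔
     cap (X i1) (U B1 10 c) + cap (X i2) (U B2 10 c) + (cap (X i3) (U B3 10 c) + cap (X i4) (U B4 10 c)) = 0 := by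
  have key : ∀ a : Fin 5 →₀ ℕ, degA a = 9 → ev c (xl4 (toL a) i1.val B1 i2.val B2 i3.val B3 i4.val B4) =
      (cap (X i1) (U B1 10 c) + cap (X i2) (U B2 10 c) + (cap (X i3) (U B3 10 c) + cap (X i4) (U B4 10 c))) (mono a) := by
    intro a ha
    rw [xl4, ev_xor, ev_xor, ev_xor, cap_bit h1 c ha, cap_bit h2 c ha, cap_bit h3 c ha, cap_bit h4 c ha]
    rfl
  constructor
  · intro h
    refine Fn_ext fun a => ?_
    by_cases ha : degA a = 9
    · rw [← key a ha, h _ (toL_mem ha)]; rfl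
    · have hs : ∀ i B, cap (X i) (U B 10 c) (mono a) = 0 := fun i B => cap_Sup (U_Sup B 10 c) i a ha
      simp only [LinearMap.add_apply, hs, LinearMap.zero_apply, add_zero]
  · intro h f hf
    have := key (ex f xs5) (degA_ex5 hf)
    rw [toL_ex ((mem_comps _ _ _).1 hf).1, h] at this
    exact this

def psi (c : ℕ → ZMod 2) : Fn 5 :=
  cap (X 0 * X 1) (U 10009 10 c) + cap (X 0 * X 2) (U 9008 10 c) + (cap (X 0 * X 3) (U 8007 10 c) + cap (X 0 * X 4) (U 7006 10 c))
  + (cap (X 1 * X 2) (U 6005 10 c) + cap (X 1 * X 3) (U 5004 10 c) + (cap (X 1 * X 4) (U 4003 10 c) + cap (X 2 * X 3) (U 3002 10 c))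
  + (cap (X 2 * X 4) (U 2001 10 c) + cap (X 3 * X 4) (U 1000 10 c)))

theorem psi_Sup (c) : Sup 8 (psi c) := by
  have h : ∀ i j B, Sup 8 (cap (X i * X j) (U B 10 c)) := by
    intro i j B
    rw [cap_mul]
    exact cap_Sup (cap_Sup (U_Sup B 10 c) j) i
  intro a ha
  have h2 := fun i j B => h i j B a ha
  simp only [psi, LinearMap.add_apply, h2, add_zero]

theorem x2_bit {B : ℕ} (hB : B ≤ 10724) (c) {t : List ℕ} (h1 : t.length = 5) (h2 : t.sum = 8) (i j : Fin 5) :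
    ev c (x2 t i.val j.val B) = cap (X i * X j) (U B 10 c) (mono (ex t xs5)) := by
  have ha : degA (ex t xs5) = 8 := by rw [degA_ex _ _ h1, h2]
  rw [x2]
  conv_lhs => rw [← toL_ex h1]
  rw [incr_toL, incr_toL, U_bit hB c (D := 10) (by rw [degA_add, degA_add, degA_single, degA_single, ha]), mul_comm, cap_mul, cap_mono,
    cap_mono, add_left_comm, add_left_comm]

theorem row2_eq (c) {d : ℕ} (hd : d < 9) {f} (hf : f ∈ comps 5 d) :
    ev c (row2 d f) = U 10724 9 c (SqT 5 (mono (ex f xs5))) + psi c (SqT 5 (mono (ex f xs5))) := by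
  rw [row2, ev_xor, ev_sqR, ev_sqR]
  refine congrArg₂ _ (sq_U (by omega) (U_Sup 10724 9 c) (by omega) hf _ fun t h1 h2 => U_bit' (by norm_num) c h1 h2)
    (sq_U (by omega) (psi_Sup c) (by omega) hf _ fun t h1 h2 => ?_)
  simp only [ev_xor]
  have key := fun (B : ℕ) (hB : B ≤ 10724) i j => x2_bit hB c h1 h2 i j
  rw [psi]
  simp only [LinearMap.add_apply]
  rw [← key _ (by norm_num) 0 1, ← key _ (by norm_num) 0 2, ← key _ (by norm_num) 0 3, ← key _ (by norm_num) 0 4, ← key _ (by norm_num) 1 2,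
    ← key _ (by norm_num) 1 3, ← key _ (by norm_num) 1 4, ← key _ (by norm_num) 2 3, ← key _ (by norm_num) 2 4, ← key _ (by norm_num) 3 4]
  rfl

theorem row2_iff (c) : (∀ d < 9, ∀ f ∈ comps 5 d, ev c (row2 d f) = 0) ↔
    ∀ f, U 10724 9 c (SqT 5 f) + psi c (SqT 5 f) = U 10724 9 c f := by
  constructor
  · intro h
    have : (U 10724 9 c + psi c) ∘ₗ (SqT 5).toLinearMap = U 10724 9 c := by
      refine Fn_ext fun a => ?_
      change U 10724 9 c (SqT 5 (mono a)) + psi c (SqT 5 (mono a)) = _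
      by_cases ha : degA a < 9
      · have h1 := row2_eq c ha (toL_mem (a := a) rfl)
        rw [h _ ha _ (toL_mem rfl), ex_toL] at h1
        rw [← h1, U_Sup _ _ _ a (by omega)]
      · rw [(U_Sup _ _ _).Sq_eq (by omega), (psi_Sup c).Sq_eq (by omega), psi_Sup c a (by omega), add_zero]
    exact fun f => LinearMap.congr_fun this f
  · intro h d hd f hf
    rw [row2_eq c hd hf, h, U_Sup]
    rw [degA_ex5 hf]; omega
end CC
end

section
namespace CC
def bs (I : Finset (Fin 5)) : ℕ :=
  if I = {0, 1, 2} then 1000 else if I = {0, 1, 3} then 2001 else if I = {0, 1, 4} then 3002 else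
  if I = {0, 2, 3} then 4003 else if I = {0, 2, 4} then 5004 else if I = {0, 3, 4} then 6005 else
  if I = {1, 2, 3} then 7006 else if I = {1, 2, 4} then 8007 else if I = {1, 3, 4} then 9008 else
  if I = {2, 3, 4} then 10009 else 10724
def vl (I : Finset (Fin 5)) : Prop := I.card = 3 ∨ I.card = 5
instance : DecidablePred vl := fun _ => inferInstanceAs (Decidable (_ ∨ _))
def dg (I : Finset (Fin 5)) : ℕ := if I.card = 3 then 10 else 9

theorem bs_mem : ∀ I, I.card = 3 → bs I ∈ bases := by decide
theorem bs_ex : ∀ B ∈ bases, ∃ I, I.card = 3 ∧ bs I = B := by decide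
theorem bs_inj : ∀ I, vl I → ∀ J, vl J → bs I = bs J → I = J := by decide +kernel
theorem bs_le : ∀ I, bs I ≤ 10724 := by decide

def Tc (c : ℕ → ZMod 2) (I : Finset (Fin 5)) : Fn 5 := if vl I then U (bs I) (dg I) c else 0
def Ps (c : ℕ → ZMod 2) : Fn 5 := mk (Tc c)
theorem par_Ps (c I) : par I (Ps c) = Tc c I := par_mk _ _
theorem Tc_zero {c I} (h : ¬ vl I) : Tc c I = 0 := if_neg h
theorem Tc_card {c} {I : Finset (Fin 5)} (h : I.card ≠ 3) (h2 : I.card ≠ 5) : Tc c I = 0 := Tc_zero (by rintro (h3 | h3) <;> omega)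
theorem Tc_three {c} {I : Finset (Fin 5)} (h : I.card = 3) {B : ℕ} (hB : bs I = B) : Tc c I = U B 10 c := by
  rw [Tc, if_pos (show vl I from Or.inl h), dg, if_pos h, hB]
theorem Tc_univ {c} : Tc c Finset.univ = U 10724 9 c := by
  rw [Tc, if_pos (show vl Finset.univ from Or.inr rfl)]; rfl

theorem Ps_Sup (c) : Sup 23 (Ps c) := by
  refine Sup_of_par fun I e he b hb => ?_
  rw [par_Ps, Tc]
  split
  · next h =>
    refine U_Sup _ _ _ b ?_
    rw [dg]
    rcases h with h | h
    · rw [if_pos h]; omega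
    · rw [if_neg (by omega)]; omega
  · rfl

theorem stL_Ps (c I f) : stL (Ps c) I f =
    ∑ j ∈ Finset.range (I.card + 1), ∑ B ∈ Finset.powersetCard j I, Tc c (I \ B) (XI B * SqT 5 f) := by
  rw [stL, Finset.sum_powerset]
  simp only [par_Ps]

theorem st_term {c} {I : Finset (Fin 5)} {f : P 5} {j : ℕ} (h3 : I.card - j ≠ 3) (h5 : I.card - j ≠ 5) :
    ∑ B ∈ Finset.powersetCard j I, Tc c (I \ B) (XI B * SqT 5 f) = 0 := by
  refine Finset.sum_eq_zero fun B hB => ?_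
  rw [Finset.mem_powersetCard] at hB
  have : (I \ B).card = I.card - j := by rw [Finset.card_sdiff_of_subset hB.1, hB.2]
  rw [Tc_card (by omega) (by omega)]; rfl

theorem st_zero {c} {I : Finset (Fin 5)} {f : P 5} :
    ∑ B ∈ Finset.powersetCard 0 I, Tc c (I \ B) (XI B * SqT 5 f) = Tc c I (SqT 5 f) := by
  rw [Finset.powersetCard_zero, Finset.sum_singleton, Finset.sdiff_empty, XI, Finset.prod_empty, one_mul]

theorem st_one {c} {I : Finset (Fin 5)} {f : P 5} :
    ∑ B ∈ Finset.powersetCard 1 I, Tc c (I \ B) (XI B * SqT 5 f) = (∑ i ∈ I, cap (X i) (Tc c (I.erase i))) (SqT 5 f) := by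
  rw [Finset.powersetCard_one, Finset.sum_map, LinearMap.sum_apply]
  refine Finset.sum_congr rfl fun i _ => ?_
  rw [cap_apply, ← Finset.sdiff_singleton_eq_erase]
  simp [XI]

theorem sum_pairs (F : Finset (Fin 5) → ZMod 2) : ∑ B ∈ Finset.powersetCard 2 Finset.univ, F B =
    F {0, 1} + F {0, 2} + (F {0, 3} + F {0, 4}) + (F {1, 2} + F {1, 3} + (F {1, 4} + F {2, 3}) + (F {2, 4} + F {3, 4})) := by
  have : Finset.powersetCard 2 (Finset.univ : Finset (Fin 5)) =
    {{0, 1}, {0, 2}, {0, 3}, {0, 4}, {1, 2}, {1, 3}, {1, 4}, {2, 3}, {2, 4}, {3, 4}} := by decide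
  rw [this]
  rw [Finset.sum_insert (by decide), Finset.sum_insert (by decide), Finset.sum_insert (by decide), Finset.sum_insert (by decide),
    Finset.sum_insert (by decide), Finset.sum_insert (by decide), Finset.sum_insert (by decide), Finset.sum_insert (by decide),
    Finset.sum_insert (by decide), Finset.sum_singleton]
  simp only [add_assoc]

theorem pair_eq {c} {g : P 5} {i j : Fin 5} (h : i ≠ j) {B : ℕ} (h3 : (Finset.univ \ {i, j}).card = 3) (hB : bs (Finset.univ \ {i, j}) = B) :
    Tc c (Finset.univ \ {i, j}) (XI {i, j} * g) = cap (X i * X j) (U B 10 c) g := by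
  rw [Tc_three h3 hB, cap_apply, XI, Finset.prod_pair h]

theorem st_two {c} {f : P 5} :
    ∑ B ∈ Finset.powersetCard 2 Finset.univ, Tc c (Finset.univ \ B) (XI B * SqT 5 f) = psi c (SqT 5 f) := by
  rw [sum_pairs, psi]
  simp only [LinearMap.add_apply]
  rw [pair_eq (by decide) (by decide) (B := 10009) (by decide), pair_eq (by decide) (by decide) (B := 9008) (by decide),
    pair_eq (by decide) (by decide) (B := 8007) (by decide), pair_eq (by decide) (by decide) (B := 7006) (by decide),
    pair_eq (by decide) (by decide) (B := 6005) (by decide), pair_eq (by decide) (by decide) (B := 5004) (by decide),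
    pair_eq (by decide) (by decide) (B := 4003) (by decide), pair_eq (by decide) (by decide) (B := 3002) (by decide),
    pair_eq (by decide) (by decide) (B := 2001) (by decide), pair_eq (by decide) (by decide) (B := 1000) (by decide)]

def S4 (c : ℕ → ZMod 2) (I : Finset (Fin 5)) : Fn 5 := ∑ i ∈ I, cap (X i) (Tc c (I.erase i))

theorem S4_Sup {c} {I : Finset (Fin 5)} (h : I.card = 4) : Sup 9 (S4 c I) := by
  refine Sup.sum fun i hi => cap_Sup ?_ i
  rw [Tc_three (by rw [Finset.card_erase_of_mem hi, h]) rfl]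
  exact U_Sup _ _ _

theorem star_Ps (c) : Ps c ∈ K 5 23 ↔ (∀ I, I.card = 3 → U (bs I) 10 c ∈ K 5 10) ∧ (∀ I, I.card = 4 → S4 c I = 0) ∧
    ∀ f, U 10724 9 c (SqT 5 f) + psi c (SqT 5 f) = U 10724 9 c f := by
  have e3 : ∀ I : Finset (Fin 5), I.card = 3 → ∀ f, stL (Ps c) I f = Tc c I (SqT 5 f) := by
    intro I h f
    rw [stL_Ps, h, Finset.sum_range_succ', Finset.sum_eq_zero, zero_add, st_zero]
    intro j _; exact st_term (by omega) (by omega)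
  have e4 : ∀ I : Finset (Fin 5), I.card = 4 → ∀ f, stL (Ps c) I f = S4 c I (SqT 5 f) := by
    intro I h f
    rw [stL_Ps, h, Finset.sum_range_succ', Finset.sum_range_succ', Finset.sum_eq_zero, zero_add, st_one, st_term (by omega) (by omega),
      add_zero, S4]
    intro j _; exact st_term (by omega) (by omega)
  have e5 : ∀ f, stL (Ps c) Finset.univ f = U 10724 9 c (SqT 5 f) + psi c (SqT 5 f) := by
    intro f
    have hc : (Finset.univ : Finset (Fin 5)).card = 5 := rfl
    rw [stL_Ps, hc, Finset.sum_range_succ', Finset.sum_range_succ', Finset.sum_range_succ', Finset.sum_eq_zero, zero_add, st_zero, st_two,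
      Tc_univ, st_term (by rw [hc]; omega) (by rw [hc]; omega), add_zero, add_comm]
    intro j _; exact st_term (by rw [hc]; omega) (by rw [hc]; omega)
  rw [mem_K, star_iff]
  constructor
  · rintro ⟨-, h⟩
    refine ⟨fun I hI => mem_K.2 ⟨U_Sup _ _ _, fun f => ?_⟩, fun I hI => ?_, fun f => ?_⟩
    · have := h I f
      rwa [e3 I hI, par_Ps, Tc_three hI rfl] at this
    · refine (S4_Sup hI).Z fun f => ?_
      have := h I f
      rw [e4 I hI, par_Ps, Tc_card (by omega) (by omega)] at this
      exact this
    · have := h Finset.univ f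
      rwa [e5, par_Ps, Tc_univ] at this
  · rintro ⟨h3, h4, h5⟩
    refine ⟨Ps_Sup c, fun I f => ?_⟩
    have hle : I.card ≤ 5 := by simpa using Finset.card_le_univ I
    rw [par_Ps]
    obtain h | h | h | h : I.card < 3 ∨ I.card = 3 ∨ I.card = 4 ∨ I.card = 5 := by omega
    · rw [stL_Ps, Tc_card (by omega) (by omega), Finset.sum_eq_zero]; · rfl
      intro j _; exact st_term (by omega) (by omega)
    · rw [e3 I h, Tc_three h rfl]; exact (h3 I h).2 f
    · rw [e4 I h, Tc_card (by omega) (by omega), h4 I h]; rfl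
    · obtain rfl : I = Finset.univ := Finset.card_eq_iff_eq_univ I |>.1 (by simpa using h)
      rw [e5, Tc_univ]; exact h5 f

theorem card4 : ∀ I : Finset (Fin 5), I.card = 4 → I = {0, 1, 2, 3} ∨ I = {0, 1, 2, 4} ∨ I = {0, 1, 3, 4} ∨ I = {0, 2, 3, 4} ∨ I = {1, 2, 3, 4} := by
  decide

theorem S4_eq {c} (i j k l : Fin 5) {a1 a2 a3 a4 : ℕ} (h : [i, j, k, l].Nodup)
    (h1 : (({i, j, k, l} : Finset (Fin 5)).erase i).card = 3 ∧ bs (({i, j, k, l} : Finset (Fin 5)).erase i) = a1)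
    (h2 : (({i, j, k, l} : Finset (Fin 5)).erase j).card = 3 ∧ bs (({i, j, k, l} : Finset (Fin 5)).erase j) = a2)
    (h3 : (({i, j, k, l} : Finset (Fin 5)).erase k).card = 3 ∧ bs (({i, j, k, l} : Finset (Fin 5)).erase k) = a3)
    (h4 : (({i, j, k, l} : Finset (Fin 5)).erase l).card = 3 ∧ bs (({i, j, k, l} : Finset (Fin 5)).erase l) = a4) :
    q1 c i.val a1 j.val a2 k.val a3 l.val a4 ↔ S4 c {i, j, k, l} = 0 := by
  rw [q1_iff c i j k l (h1.2 ▸ bs_le _) (h2.2 ▸ bs_le _) (h3.2 ▸ bs_le _) (h4.2 ▸ bs_le _), ← Tc_three h1.1 h1.2, ← Tc_three h2.1 h2.2,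
    ← Tc_three h3.1 h3.2, ← Tc_three h4.1 h4.2, S4]
  simp only [List.nodup_cons, List.mem_cons, List.not_mem_nil, or_false, not_or] at h
  rw [Finset.sum_insert (by simp; tauto), Finset.sum_insert (by simp; tauto), Finset.sum_insert (by simp; tauto), Finset.sum_singleton]
  simp only [add_assoc]

theorem Ps_iff (c) : Ps c ∈ K 5 23 ↔ ∀ v ∈ flat fin [], ev c v = 0 := by
  rw [star_Ps, fin_spec, row2_iff]
  refine and_congr ?_ (and_congr_left' ?_)
  · constructor
    · intro h B hB
      obtain ⟨I, hI, rfl⟩ := bs_ex B hB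
      exact (U_K (bs_le I) c).2 (h I hI)
    · intro h I hI
      exact (U_K (bs_le I) c).1 (h _ (bs_mem I hI))
  · have f1 := S4_eq (c := c) 0 1 2 3 (a1 := 7006) (a2 := 4003) (a3 := 2001) (a4 := 1000) (by decide) (by decide) (by decide) (by decide) (by decide)
    have f2 := S4_eq (c := c) 0 1 2 4 (a1 := 8007) (a2 := 5004) (a3 := 3002) (a4 := 1000) (by decide) (by decide) (by decide) (by decide) (by decide)
    have f3 := S4_eq (c := c) 0 1 3 4 (a1 := 9008) (a2 := 6005) (a3 := 3002) (a4 := 2001) (by decide) (by decide) (by decide) (by decide) (by decide)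
    have f4 := S4_eq (c := c) 0 2 3 4 (a1 := 10009) (a2 := 6005) (a3 := 5004) (a4 := 4003) (by decide) (by decide) (by decide) (by decide) (by decide)
    have f5 := S4_eq (c := c) 1 2 3 4 (a1 := 10009) (a2 := 9008) (a3 := 8007) (a4 := 7006) (by decide) (by decide) (by decide) (by decide) (by decide)
    constructor
    · intro h
      exact ⟨f1.2 (h _ rfl), f2.2 (h _ rfl), f3.2 (h _ rfl), f4.2 (h _ rfl), f5.2 (h _ rfl)⟩
    · rintro ⟨g1, g2, g3, g4, g5⟩ I hI
      rcases card4 I hI with rfl | rfl | rfl | rfl | rfl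
      · exact f1.1 g1
      · exact f2.1 g2
      · exact f3.1 g3
      · exact f4.1 g4
      · exact f5.1 g5
end CC
end

section
namespace CC
theorem U_lin (B D : ℕ) (c c' : ℕ → ZMod 2) (r : ZMod 2) : U B D (c + r • c') = U B D c + r • U B D c' := by
  refine Fn_ext fun a => ?_
  rw [LinearMap.add_apply, LinearMap.smul_apply, U_mono, U_mono, U_mono]
  split <;> simp

theorem Ps_lin (c c' : ℕ → ZMod 2) (r : ZMod 2) : Ps (c + r • c') = Ps c + r • Ps c' := by
  refine par_ext fun I => ?_
  rw [map_add, map_smul, par_Ps, par_Ps, par_Ps, Tc, Tc, Tc]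
  split
  · exact U_lin _ _ _ _ _
  · simp

def PsL : (Fin 10725 → ZMod 2) →ₗ[ZMod 2] Fn 5 where
  toFun c := Ps (ext0 c)
  map_add' c c' := by
    have := Ps_lin (ext0 c) (ext0 c') 1
    rwa [one_smul, one_smul, ← map_add] at this
  map_smul' r c := by
    have h0 : Ps (0 + (1 : ZMod 2) • 0) = Ps 0 + (1 : ZMod 2) • Ps 0 := Ps_lin 0 0 1
    have h1 : Ps 0 = 0 := by simpa using h0
    have := Ps_lin 0 (ext0 c) r
    rwa [h1, zero_add, zero_add, ← map_smul] at this

theorem rk10 {t : List ℕ} (h : t ∈ comps 5 10) : rk t < 1001 := by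
  have : rk t ∈ (comps 5 10).map rk := List.mem_map_of_mem h
  rw [ck10] at this; simpa using this
theorem rk9 {t : List ℕ} (h : t ∈ comps 5 9) : rk t < 715 := by
  have : rk t ∈ (comps 5 9).map rk := List.mem_map_of_mem h
  rw [ck9] at this; simpa using this
theorem rk10_ex {n : ℕ} (h : n < 1001) : ∃ t ∈ comps 5 10, rk t = n := by
  have : n ∈ (comps 5 10).map rk := by rw [ck10]; simpa using h
  exact List.mem_map.1 this
theorem rk9_ex {n : ℕ} (h : n < 715) : ∃ t ∈ comps 5 9, rk t = n := by
  have : n ∈ (comps 5 9).map rk := by rw [ck9]; simpa using h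
  exact List.mem_map.1 this
theorem rk10_inj {t s : List ℕ} (ht : t ∈ comps 5 10) (hs : s ∈ comps 5 10) (h : rk t = rk s) : t = s :=
  List.inj_on_of_nodup_map (f := rk) (by rw [ck10]; simpa using List.nodup_range) ht hs h
theorem rk9_inj {t s : List ℕ} (ht : t ∈ comps 5 9) (hs : s ∈ comps 5 9) (h : rk t = rk s) : t = s :=
  List.inj_on_of_nodup_map (f := rk) (by rw [ck9]; simpa using List.nodup_range) ht hs h

theorem bs_form : ∀ I, I.card = 3 → ∃ q < 10, bs I = 1001 * q + 1000 := by decide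
theorem bs_form_ex : ∀ q < 10, ∃ I, I.card = 3 ∧ bs I = 1001 * q + 1000 := by decide
theorem bs_univ : bs Finset.univ = 10724 := by decide
theorem vl_cases {I} (h : vl I) : (I.card = 3) ∨ I = Finset.univ := by
  rcases h with h | h
  · exact Or.inl h
  · exact Or.inr (Finset.card_eq_iff_eq_univ I |>.1 (by simpa using h))

theorem PsL_inj : Function.Injective PsL := by
  rw [← LinearMap.ker_eq_bot, LinearMap.ker_eq_bot']
  intro c hc
  have hT : ∀ I, Tc (ext0 c) I = 0 := fun I => by
    rw [← par_Ps]; change par I (PsL c) = 0; rw [hc, map_zero]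
  have key : ∀ i : ℕ, i < 10725 → ext0 c i = 0 := by
    intro i hi
    by_cases h : i < 10010
    · obtain ⟨I, hI, hb⟩ := bs_form_ex (i / 1001) (by omega)
      obtain ⟨t, ht, hr⟩ := rk10_ex (n := 1000 - i % 1001) (by omega)
      have h1 := hT I
      rw [Tc_three hI hb] at h1
      have h2 : U (1001 * (i / 1001) + 1000) 10 (ext0 c) (mono (ex t xs5)) = 0 := by rw [h1]; rfl
      rw [U_mono, if_pos (degA_ex5 ht), toL_ex ((mem_comps _ _ _).1 ht).1, hr] at h2
      have e : 1001 * (i / 1001) + 1000 - (1000 - i % 1001) = i := by omega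
      rwa [e] at h2
    · obtain ⟨t, ht, hr⟩ := rk9_ex (n := 10724 - i) (by omega)
      have h1 := hT Finset.univ
      rw [Tc_univ] at h1
      have h2 : U 10724 9 (ext0 c) (mono (ex t xs5)) = 0 := by rw [h1]; rfl
      rw [U_mono, if_pos (degA_ex5 ht), toL_ex ((mem_comps _ _ _).1 ht).1, hr] at h2
      have e : 10724 - (10724 - i) = i := by omega
      rwa [e] at h2
  ext i
  have := key i i.2
  simpa [ext0] using this

def VI : Type := {x : Finset (Fin 5) × (Fin 5 →₀ ℕ) // vl x.1 ∧ degA x.2 = dg x.1}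
def idx (x : VI) : ℕ := bs x.1.1 - rk (toL x.1.2)

theorem toL_inj {a b : Fin 5 →₀ ℕ} (h : toL a = toL b) : a = b := by rw [← ex_toL a, h, ex_toL]

theorem dg3 {I : Finset (Fin 5)} (h : I.card = 3) : dg I = 10 := if_pos h
theorem dg5 : dg Finset.univ = 9 := rfl

theorem idx_inj : Function.Injective idx := by
  rintro ⟨⟨I, a⟩, hI, ha⟩ ⟨⟨J, b⟩, hJ, hb⟩ h
  change bs I - rk (toL a) = bs J - rk (toL b) at h
  simp only at hI ha hJ hb
  have hIJ : bs I = bs J ∧ rk (toL a) = rk (toL b) := by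
    rcases vl_cases hI with h1 | h1
    · rw [dg3 h1] at ha
      have r1 := rk10 (toL_mem ha)
      obtain ⟨q, hq, hq2⟩ := bs_form I h1
      rcases vl_cases hJ with h2 | h2
      · rw [dg3 h2] at hb
        have r2 := rk10 (toL_mem hb)
        obtain ⟨p, hp, hp2⟩ := bs_form J h2
        omega
      · subst h2
        rw [dg5] at hb
        have r2 := rk9 (toL_mem hb)
        rw [bs_univ] at h ⊢
        omega
    · subst h1
      rw [dg5] at ha
      have r1 := rk9 (toL_mem ha)
      rw [bs_univ] at h ⊢
      rcases vl_cases hJ with h2 | h2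
      · rw [dg3 h2] at hb
        have r2 := rk10 (toL_mem hb)
        obtain ⟨p, hp, hp2⟩ := bs_form J h2
        omega
      · subst h2
        rw [dg5] at hb
        have r2 := rk9 (toL_mem hb)
        rw [bs_univ] at h ⊢
        omega
  obtain rfl := bs_inj I hI J hJ hIJ.1
  have : a = b := by
    apply toL_inj
    rcases vl_cases hI with h1 | h1
    · rw [dg3 h1] at ha hb
      exact rk10_inj (toL_mem ha) (toL_mem hb) hIJ.2
    · subst h1
      rw [dg5] at ha hb
      exact rk9_inj (toL_mem ha) (toL_mem hb) hIJ.2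
  subst this
  rfl

theorem K_range {φ : Fn 5} (h : φ ∈ K 5 23) : ∃ c, PsL c = φ := by
  let c : ℕ → ZMod 2 := Function.extend idx (fun x => par x.1.1 φ (mono x.1.2)) 0
  refine ⟨fun i => c i, par_ext fun I => ?_⟩
  change par I (Ps _) = _
  rw [par_Ps]
  by_cases hI : vl I
  · rw [Tc, if_pos hI]
    refine Fn_ext fun a => ?_
    have hS : Sup (dg I) (par I φ) := by
      refine par_Sup h.1 ?_
      rcases vl_cases hI with h1 | h1
      · rw [dg3 h1, h1]
      · subst h1; rfl
    rw [U_mono]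
    by_cases ha : degA a = dg I
    · rw [if_pos ha]
      have h1 := idx_inj.extend_apply (fun x : VI => par x.1.1 φ (mono x.1.2)) 0 ⟨(I, a), hI, ha⟩
      have h2 : bs I - rk (toL a) < 10725 := by have := bs_le I; omega
      refine Eq.trans ?_ h1
      change (if h : bs I - rk (toL a) < 10725 then c _ else 0) = c _
      rw [dif_pos h2]; rfl
    · rw [if_neg ha, hS a ha]
  · rw [Tc_zero hI]
    symm
    have hle : I.card ≤ 5 := by simpa using Finset.card_le_univ I
    have h3 : I.card ≠ 3 := fun h => hI (Or.inl h)
    have h5 : I.card ≠ 5 := fun h => hI (Or.inr h)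
    by_cases h1 : I.card = 1
    · refine vanish h I (e := 11) (by omega) ?_
      rw [h1]
      rintro ⟨j, m, hm, hh⟩
      simp [powSum] at hm; subst hm
      rcases j with _ | _ | _ | _ | j
      · simp at hh
      · simp at hh
      · simp at hh
      · simp at hh
      · rw [pow_succ, pow_succ, pow_succ, pow_succ] at hh; omega
    · exact par_zero_parity h.1 (fun e => by omega)

theorem finrank_K523 : Module.finrank (ZMod 2) (K 5 23) = 1245 := by
  have h : (WW (flat fin [])).map PsL = K 5 23 := by
    ext φ
    rw [Submodule.mem_map]
    constructor
    · rintro ⟨c, hc, rfl⟩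
      exact (Ps_iff _).2 (mem_WW.1 hc)
    · intro hφ
      obtain ⟨c, rfl⟩ := K_range hφ
      exact ⟨c, mem_WW.2 ((Ps_iff _).1 hφ), rfl⟩
  rw [← h, ← (Submodule.equivMapOfInjective PsL PsL_inj (WW (flat fin []))).finrank_eq]
  exact finrank_WW compute
end CC
end

/-- for every `r ≥ 1`, `(QP_6)_{5(2^{r+4}-1)+23·2^{r+4}}` has dimension
`78435`, and there are exactly `78435` admissible monomials of that degree in `P_6`. -/
theorem statement10 (r : ℕ) (hr : 1 ≤ r) :
    Module.finrank (ZMod 2) (QP 6 (5 * (2 ^ (r + 4) - 1) + 23 * 2 ^ (r + 4))) = 78435 ∧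
    {a : Fin 6 →₀ ℕ |
      degA a = 5 * (2 ^ (r + 4) - 1) + 23 * 2 ^ (r + 4) ∧ Admissible a}.ncard = 78435 := final_of CC.finrank_K523 r hr

end
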